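/- Let N ≥ 4 be a real number, n ∈ ℕ, M > 0, and let b₂, b₁, b₀ ∈ C^∞([0,1]) satisfy |b₂(z) − 1| ≤ 1/2 for all z ∈ [0,1] and |b⃗|₆ ≤ M, where b⃗ = (b₂,b₁,b₀). Define 𝒜y = −b₂·Δy + b₁·Ďy + b₀·y. Then there is a constant C = C(n, M, N) such that for all y ∈ C^∞([0,1]): ‖y‖_{n+2} ≤ C·( ‖𝒜y‖_n + (1 + |b⃗|_{n+4})·‖y‖₁ ). -/

import Mathlib

open MeasureTheory Real Set

noncomputable section

/-- The degenerate operator `Δy(z) = z y''(z) + (N/2) y'(z)`. -/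
def Del (N : ℝ) (f : ℝ → ℝ) : ℝ → ℝ :=
  fun z => z * deriv (deriv f) z + (N / 2) * deriv f z

/-- Iterates `Δ^m`. -/
def DelIter (N : ℝ) : ℕ → (ℝ → ℝ) → ℝ → ℝ
  | 0 => fun f => f
  | m + 1 => fun f => Del N (DelIter N m f)

/-- `Ḋ = √z d/dz`. -/
def Ddot (f : ℝ → ℝ) : ℝ → ℝ := fun z => Real.sqrt z * deriv f z

/-- The weighted L² norm on (0,1). -/
def Xnorm (N : ℝ) (f : ℝ → ℝ) : ℝ :=
  Real.sqrt (∫ z in (0:ℝ)..1, (f z) ^ 2 * z ^ (N / 2 - 1))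

/-- Graded seminorms `(y)_ℓ`. -/
def gnorm (N : ℝ) (ℓ : ℕ) (f : ℝ → ℝ) : ℝ :=
  if ℓ % 2 = 0 then Xnorm N (DelIter N (ℓ / 2) f)
  else Xnorm N (Ddot (DelIter N (ℓ / 2) f))

/-- Graded norm `‖y‖_n`. -/
def normN (N : ℝ) (n : ℕ) (f : ℝ → ℝ) : ℝ :=
  Real.sqrt (∑ ℓ ∈ Finset.range (n + 1), (gnorm N ℓ f) ^ 2)

/-- Sup norm on [0,1]. -/
def supN (f : ℝ → ℝ) : ℝ := ⨆ z : Icc (0:ℝ) 1, |f z.1|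

/-- `|y|_n = ∑_{ℓ≤n} ‖Ḋ^ℓ y‖_{L^∞(0,1)}`. -/
def supLow (n : ℕ) (f : ℝ → ℝ) : ℝ := ∑ ℓ ∈ Finset.range (n + 1), supN (Ddot^[ℓ] f)

/-- Time derivative of a function of (t,z). -/
def dt (y : ℝ → ℝ → ℝ) : ℝ → ℝ → ℝ := fun t z => deriv (fun s => y s z) t

/-- Sup norm on [0,T]×[0,1]. -/
def supT (T : ℝ) (y : ℝ → ℝ → ℝ) : ℝ :=
  ⨆ (t : Icc (0:ℝ) T) (z : Icc (0:ℝ) 1), |y t.1 z.1|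

/-- `|y|_n^T = sup_{j+k≤n} ‖∂_t^j Ḋ^k y‖_{L^∞([0,T]×[0,1])}`. -/
def supNT (T : ℝ) (n : ℕ) (y : ℝ → ℝ → ℝ) : ℝ :=
  ⨆ p : {p : ℕ × ℕ // p.1 + p.2 ≤ n}, supT T (fun t => Ddot^[p.1.2] (dt^[p.1.1] y t))

/-- `‖y‖_n^T`. -/
def normT (N T : ℝ) (n : ℕ) (y : ℝ → ℝ → ℝ) : ℝ :=
  Real.sqrt (∑ j ∈ Finset.range (n + 1), ∑ k ∈ Finset.range (n + 1 - j),
    ∫ t in (0:ℝ)..T, (normN N k (dt^[j] y t)) ^ 2)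

/-- `Z_n(H)(t) = ∑_{j+k=n} ‖∂_t^j H(t,·)‖_k`. -/
def ZZ (N : ℝ) (n : ℕ) (H : ℝ → ℝ → ℝ) (t : ℝ) : ℝ :=
  ∑ j ∈ Finset.range (n + 1), normN N (n - j) (dt^[j] H t)

/-- The operator `𝒜h = -b₂ Δh + b₁ Ďh + b₀ h` with time-dependent coefficients. -/
def opA (N : ℝ) (b₂ b₁ b₀ : ℝ → ℝ → ℝ) (H : ℝ → ℝ → ℝ) : ℝ → ℝ → ℝ :=
  fun t z => -(b₂ t z) * Del N (H t) z + b₁ t z * (z * deriv (H t) z) + b₀ t z * H t z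

end

noncomputable section
/-- The stationary operator `𝒜y = -b₂ Δy + b₁ Ďy + b₀ y`. -/
def opAs (N : ℝ) (b₂ b₁ b₀ : ℝ → ℝ) (y : ℝ → ℝ) : ℝ → ℝ :=
  fun z => -(b₂ z) * Del N y z + b₁ z * (z * deriv y z) + b₀ z * y z
end

/-- Smooth functions. -/
abbrev Sm (f : ℝ → ℝ) : Prop := ContDiff ℝ (⊤ : ℕ∞) f

lemma Sm.der {f : ℝ → ℝ} (hf : Sm f) : Sm (deriv f) := by
  have h : ContDiff ℝ ((⊤ : ℕ∞) + 1) f := hf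
  exact (contDiff_succ_iff_deriv.1 h).2.2

lemma Sm.iter {f : ℝ → ℝ} (hf : Sm f) (k : ℕ) : Sm (iteratedDeriv k f) := by
  induction k with
  | zero => simpa using hf
  | succ k ih => rw [iteratedDeriv_succ]; exact ih.der

lemma Sm.hd {f : ℝ → ℝ} (hf : Sm f) (z : ℝ) : HasDerivAt f (deriv f z) z :=
  (hf.differentiable (by simp) z).hasDerivAt

lemma Sm.hdi {f : ℝ → ℝ} (hf : Sm f) (k : ℕ) (z : ℝ) :
    HasDerivAt (iteratedDeriv k f) (iteratedDeriv (k+1) f z) z := by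
  rw [iteratedDeriv_succ]; exact (hf.iter k).hd z

lemma Sm.zmul {f : ℝ → ℝ} (hf : Sm f) : Sm (fun z => z * f z) := contDiff_id.mul hf

lemma Sm.del {f : ℝ → ℝ} (hf : Sm f) (N : ℝ) : Sm (Del N f) :=
  (contDiff_id.mul hf.der.der).add (contDiff_const.mul hf.der)

lemma Sm.delIter {f : ℝ → ℝ} (hf : Sm f) (N : ℝ) (m : ℕ) : Sm (DelIter N m f) := by
  induction m with
  | zero => exact hf
  | succ m ih => exact ih.del N

lemma delIter_succ' (N : ℝ) (m : ℕ) (f : ℝ → ℝ) :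
    DelIter N (m+1) f = DelIter N m (Del N f) := by
  induction m with
  | zero => rfl
  | succ m ih => show Del N (DelIter N (m+1) f) = Del N (DelIter N m (Del N f)); rw [ih]

/-- The operator of order `ℓ` in the graded seminorm. -/
noncomputable def Lop (N : ℝ) (ℓ : ℕ) (f : ℝ → ℝ) : ℝ → ℝ :=
  if ℓ % 2 = 0 then DelIter N (ℓ / 2) f else Ddot (DelIter N (ℓ / 2) f)

lemma gnorm_eq (N : ℝ) (ℓ : ℕ) (f : ℝ → ℝ) : gnorm N ℓ f = Xnorm N (Lop N ℓ f) := by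
  unfold gnorm Lop; split_ifs <;> rfl

lemma Lop_even (N : ℝ) (m : ℕ) (f : ℝ → ℝ) : Lop N (2*m) f = DelIter N m f := by
  unfold Lop; simp

lemma Lop_odd (N : ℝ) (m : ℕ) (f : ℝ → ℝ) : Lop N (2*m+1) f = Ddot (DelIter N m f) := by
  unfold Lop
  have h1 : (2*m+1) % 2 ≠ 0 := by omega
  have h2 : (2*m+1) / 2 = m := by omega
  rw [if_neg h1, h2]

lemma Lop_zero (N : ℝ) (f : ℝ → ℝ) : Lop N 0 f = f := Lop_even N 0 f

lemma Lop_one (N : ℝ) (f : ℝ → ℝ) : Lop N 1 f = Ddot f := Lop_odd N 0 f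

lemma Lop_add_two (N : ℝ) (ℓ : ℕ) (f : ℝ → ℝ) : Lop N (ℓ+2) f = Lop N ℓ (Del N f) := by
  unfold Lop
  have h1 : (ℓ+2) % 2 = ℓ % 2 := by omega
  have h2 : (ℓ+2)/2 = ℓ/2 + 1 := by omega
  rw [h1, h2, delIter_succ']

/-- derivatives of `z f` -/
lemma iter_zmul {f : ℝ → ℝ} (hf : Sm f) (k : ℕ) (z : ℝ) :
    iteratedDeriv (k+1) (fun z => z * f z) z
      = z * iteratedDeriv (k+1) f z + (k+1) * iteratedDeriv k f z := by
  induction k generalizing z with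
  | zero =>
    have := ((hasDerivAt_id z).mul (hf.hd z)).deriv
    simp only [zero_add, iteratedDeriv_one, iteratedDeriv_zero]
    refine Eq.trans this ?_
    simp; ring
  | succ k ih =>
    rw [iteratedDeriv_succ, funext ih]
    have := (((hasDerivAt_id z).mul (hf.hdi (k+1) z)).add ((hf.hdi k z).const_mul ((k:ℝ)+1))).deriv
    refine Eq.trans this ?_
    simp; ring

lemma iter_shift (f : ℝ → ℝ) (k : ℕ) : iteratedDeriv k (deriv f) = iteratedDeriv (k+1) f := by
  rw [iteratedDeriv_succ']

/-- derivatives of `Δ f` -/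
lemma iter_del {f : ℝ → ℝ} (hf : Sm f) (N : ℝ) (k : ℕ) (z : ℝ) :
    iteratedDeriv k (Del N f) z
      = z * iteratedDeriv (k+2) f z + (N/2 + k) * iteratedDeriv (k+1) f z := by
  induction k generalizing z with
  | zero =>
    simp only [iteratedDeriv_zero, Del, ← iter_shift]
    simp
  | succ k ih =>
    rw [iteratedDeriv_succ, funext ih]
    have := (((hasDerivAt_id z).mul (hf.hdi (k+2) z)).add ((hf.hdi (k+1) z).const_mul (N/2+k))).deriv
    refine Eq.trans this ?_
    simp; ring

/-- Scale-homogeneous differential operators of order `r`. -/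
inductive IsOrd (r : ℕ) : ((ℝ → ℝ) → ℝ → ℝ) → Prop
  | base (k : ℕ) (h1 : k ≤ r) (h2 : r ≤ 2 * k) :
      IsOrd r (fun f z => Real.sqrt z ^ (2*k-r) * iteratedDeriv k f z)
  | add (S T : (ℝ → ℝ) → ℝ → ℝ) (hS : IsOrd r S) (hT : IsOrd r T) :
      IsOrd r (fun f z => S f z + T f z)
  | smul (c : ℝ) (T : (ℝ → ℝ) → ℝ → ℝ) (hT : IsOrd r T) : IsOrd r (fun f z => c * T f z)

lemma IsOrd.del {r : ℕ} {T : (ℝ → ℝ) → ℝ → ℝ} (hT : IsOrd r T) (N : ℝ) :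
    ∃ T', IsOrd (r+2) T' ∧ ∀ f, Sm f → ∀ z, 0 ≤ z → T (Del N f) z = T' f z := by
  induction hT with
  | base k h1 h2 =>
    refine ⟨_, (IsOrd.base (k+2) (by omega) (by omega)).add _ _
      ((IsOrd.base (k+1) (by omega) (by omega)).smul (N/2+k) _), ?_⟩
    intro f hf z hz
    simp only [iter_del hf]
    have e1 : 2*(k+2)-(r+2) = (2*k-r)+2 := by omega
    have e2 : 2*(k+1)-(r+2) = 2*k-r := by omega
    rw [e1, e2, pow_add, Real.sq_sqrt hz]; ring
  | add S T hS hT ihS ihT =>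
    obtain ⟨S', h1, h2⟩ := ihS
    obtain ⟨T', h3, h4⟩ := ihT
    exact ⟨_, h1.add _ _ h3, fun f hf z hz => by simp only [h2 f hf z hz, h4 f hf z hz]⟩
  | smul c T hT ihT =>
    obtain ⟨T', h3, h4⟩ := ihT
    exact ⟨_, h3.smul c _, fun f hf z hz => by simp only [h4 f hf z hz]⟩

lemma Lop_ord (N : ℝ) (r : ℕ) :
    ∃ T, IsOrd r T ∧ ∀ f, Sm f → ∀ z, 0 ≤ z → Lop N r f z = T f z := by
  induction r using Nat.twoStepInduction with
  | zero => exact ⟨_, IsOrd.base 0 le_rfl le_rfl, fun f _ z _ => by simp [Lop_zero]⟩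
  | one => exact ⟨_, IsOrd.base 1 le_rfl (by norm_num), fun f _ z _ => by simp [Lop_one, Ddot]⟩
  | more r ih _ =>
    obtain ⟨T, h1, h2⟩ := ih
    obtain ⟨T', h3, h4⟩ := h1.del N
    exact ⟨T', h3, fun f hf z hz => by rw [Lop_add_two, h2 _ (hf.del N) z hz, h4 f hf z hz]⟩

lemma cont_mono {f : ℝ → ℝ} (hf : Sm f) (j k : ℕ) :
    Continuous (fun z => Real.sqrt z ^ j * iteratedDeriv k f z) :=
  (Real.continuous_sqrt.pow j).mul (hf.iter k).continuous

lemma IsOrd.cont {r : ℕ} {T : (ℝ → ℝ) → ℝ → ℝ} (hT : IsOrd r T) {f : ℝ → ℝ} (hf : Sm f) :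
    Continuous (T f) := by
  induction hT with
  | base k h1 h2 => exact cont_mono hf _ _
  | add S T hS hT ihS ihT => exact ihS.add ihT
  | smul c T hT ihT => exact continuous_const.mul ihT

lemma iter_add {f g : ℝ → ℝ} (hf : Sm f) (hg : Sm g) (k : ℕ) (z : ℝ) :
    iteratedDeriv k (fun z => f z + g z) z = iteratedDeriv k f z + iteratedDeriv k g z := by
  induction k generalizing z with
  | zero => simp
  | succ k ih =>
    rw [iteratedDeriv_succ, funext ih]
    exact ((hf.hdi k z).add (hg.hdi k z)).deriv

lemma IsOrd.map_add {r : ℕ} {T : (ℝ → ℝ) → ℝ → ℝ} (hT : IsOrd r T) {f g : ℝ → ℝ}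
    (hf : Sm f) (hg : Sm g) (z : ℝ) : T (fun z => f z + g z) z = T f z + T g z := by
  induction hT with
  | base k h1 h2 => simp only [iter_add hf hg]; ring
  | add S T hS hT ihS ihT => simp only [ihS, ihT]; ring
  | smul c T hT ihT => simp only [ihT]; ring

lemma Sm.lopc {f : ℝ → ℝ} (hf : Sm f) (N : ℝ) (r : ℕ) : Continuous (Lop N r f) := by
  unfold Lop
  split_ifs
  · exact (hf.delIter N _).continuous
  · exact Real.continuous_sqrt.mul (hf.delIter N _).der.continuous

lemma Lop_add (N : ℝ) (r : ℕ) {f g : ℝ → ℝ} (hf : Sm f) (hg : Sm g) (z : ℝ) (hz : 0 ≤ z) :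
    Lop N r (fun z => f z + g z) z = Lop N r f z + Lop N r g z := by
  obtain ⟨T, h1, h2⟩ := Lop_ord N r
  rw [h2 _ (hf.add hg) z hz, h2 f hf z hz, h2 g hg z hz, h1.map_add hf hg]

/-- The weighted inner product. -/
noncomputable def ip (N : ℝ) (f g : ℝ → ℝ) : ℝ := ∫ z in (0:ℝ)..1, f z * g z * z ^ (N / 2 - 1)

lemma wcont {N : ℝ} (hN : 4 ≤ N) : Continuous (fun z : ℝ => z ^ (N / 2 - 1)) :=
  Real.continuous_rpow_const (by linarith)

lemma ip_self (N : ℝ) (f : ℝ → ℝ) : Xnorm N f = Real.sqrt (ip N f f) := by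
  unfold Xnorm ip; simp only [pow_two]

lemma ip_self_nonneg (N : ℝ) (f : ℝ → ℝ) : 0 ≤ ip N f f := by
  unfold ip
  apply intervalIntegral.integral_nonneg zero_le_one
  intro z hz
  exact mul_nonneg (mul_self_nonneg _) (Real.rpow_nonneg hz.1 _)

lemma Xnorm_nonneg (N : ℝ) (f : ℝ → ℝ) : 0 ≤ Xnorm N f := Real.sqrt_nonneg _

lemma Xnorm_sq (N : ℝ) (f : ℝ → ℝ) : Xnorm N f ^ 2 = ip N f f := by
  rw [ip_self, Real.sq_sqrt (ip_self_nonneg N f)]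

lemma ip_int {N : ℝ} (hN : 4 ≤ N) {f g : ℝ → ℝ} (hf : Continuous f) (hg : Continuous g) :
    IntervalIntegrable (fun z => f z * g z * z ^ (N / 2 - 1)) volume 0 1 :=
  ((hf.mul hg).mul (wcont hN)).intervalIntegrable _ _

lemma ip_quad {N : ℝ} (hN : 4 ≤ N) {f g : ℝ → ℝ} (hf : Continuous f) (hg : Continuous g) (t : ℝ) :
    ip N (fun z => f z + t * g z) (fun z => f z + t * g z)
      = ip N g g * (t * t) + 2 * ip N f g * t + ip N f f := by
  unfold ip
  have h1 := (ip_int hN hg hg).const_mul (t*t)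
  have h2 := (ip_int hN hf hg).const_mul (2*t)
  have h3 := ip_int hN hf hf
  rw [show (fun z => (f z + t * g z) * (f z + t * g z) * z ^ (N / 2 - 1))
    = fun z => ((t*t) * (g z * g z * z ^ (N / 2 - 1)) + (2*t) * (f z * g z * z ^ (N / 2 - 1)))
      + f z * f z * z ^ (N / 2 - 1) from funext fun z => by ring]
  rw [intervalIntegral.integral_add (h1.add h2) h3, intervalIntegral.integral_add h1 h2,
    intervalIntegral.integral_const_mul, intervalIntegral.integral_const_mul]
  ring

lemma ip_cs {N : ℝ} (hN : 4 ≤ N) {f g : ℝ → ℝ} (hf : Continuous f) (hg : Continuous g) :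
    |ip N f g| ≤ Xnorm N f * Xnorm N g := by
  have h := discrim_le_zero (a := ip N g g) (b := 2 * ip N f g) (c := ip N f f) (fun t => by
    rw [← ip_quad hN hf hg t]; exact ip_self_nonneg _ _)
  unfold discrim at h
  apply abs_le_of_sq_le_sq _ (mul_nonneg (Xnorm_nonneg _ _) (Xnorm_nonneg _ _))
  rw [mul_pow, Xnorm_sq, Xnorm_sq]; nlinarith

lemma Xnorm_add {N : ℝ} (hN : 4 ≤ N) {f g : ℝ → ℝ} (hf : Continuous f) (hg : Continuous g) :
    Xnorm N (fun z => f z + g z) ≤ Xnorm N f + Xnorm N g := by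
  have h := ip_quad hN hf hg 1
  simp only [one_mul, mul_one] at h
  rw [← Xnorm_sq, ← Xnorm_sq, ← Xnorm_sq] at h
  have h2 := (abs_le.1 (ip_cs hN hf hg)).2
  apply le_of_sq_le_sq _ (add_nonneg (Xnorm_nonneg _ _) (Xnorm_nonneg _ _))
  nlinarith

lemma Xnorm_smul (N c : ℝ) (f : ℝ → ℝ) : Xnorm N (fun z => c * f z) = |c| * Xnorm N f := by
  unfold Xnorm
  rw [show (fun z => (c * f z)^2 * z ^ (N / 2 - 1)) = fun z => c^2 * ((f z)^2 * z ^ (N / 2 - 1)) from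
    funext fun z => by ring]
  rw [intervalIntegral.integral_const_mul, Real.sqrt_mul (sq_nonneg c), Real.sqrt_sq_eq_abs]

lemma Xnorm_mono {N : ℝ} (hN : 4 ≤ N) {f g : ℝ → ℝ} (hf : Continuous f) (hg : Continuous g)
    (h : ∀ z ∈ Ioc (0:ℝ) 1, |f z| ≤ |g z|) : Xnorm N f ≤ Xnorm N g := by
  unfold Xnorm
  apply Real.sqrt_le_sqrt
  apply intervalIntegral.integral_mono_on_of_le_Ioo zero_le_one
  · exact ((hf.pow 2).mul (wcont hN)).intervalIntegrable _ _
  · exact ((hg.pow 2).mul (wcont hN)).intervalIntegrable _ _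
  · intro z hz
    exact mul_le_mul_of_nonneg_right (sq_le_sq.2 (h z ⟨hz.1, hz.2.le⟩)) (Real.rpow_nonneg hz.1.le _)

lemma Xnorm_congr {N : ℝ} (hN : 4 ≤ N) {f g : ℝ → ℝ} (hf : Continuous f) (hg : Continuous g)
    (h : ∀ z ∈ Ioc (0:ℝ) 1, f z = g z) : Xnorm N f = Xnorm N g :=
  le_antisymm (Xnorm_mono hN hf hg fun z hz => by rw [h z hz])
    (Xnorm_mono hN hg hf fun z hz => by rw [h z hz])

lemma Xnorm_mul_le {N : ℝ} (hN : 4 ≤ N) {b f : ℝ → ℝ} (hb : Continuous b) (hf : Continuous f)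
    {B : ℝ} (h : ∀ z ∈ Ioc (0:ℝ) 1, |b z| ≤ B) : Xnorm N (fun z => b z * f z) ≤ B * Xnorm N f := by
  have hB : 0 ≤ B := (abs_nonneg _).trans (h 1 ⟨one_pos, le_rfl⟩)
  rw [← abs_of_nonneg hB, ← Xnorm_smul]
  refine Xnorm_mono hN (hb.mul hf) (continuous_const.mul hf) fun z hz => ?_
  rw [abs_mul, abs_mul, abs_of_nonneg hB]
  exact mul_le_mul_of_nonneg_right (h z hz) (abs_nonneg _)

lemma Xnorm_zero (N : ℝ) : Xnorm N (fun _ => 0) = 0 := by unfold Xnorm; simp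

lemma Xnorm_sum {N : ℝ} (hN : 4 ≤ N) {ι : Type*} (s : Finset ι) (f : ι → ℝ → ℝ)
    (hf : ∀ i ∈ s, Continuous (f i)) :
    Xnorm N (fun z => ∑ i ∈ s, f i z) ≤ ∑ i ∈ s, Xnorm N (f i) := by
  classical
  induction s using Finset.induction_on with
  | empty => simp [Xnorm_zero]
  | insert a s ha ih =>
    simp only [Finset.sum_insert ha]
    have h1 : ∀ i ∈ s, Continuous (f i) := fun i hi => hf i (Finset.mem_insert_of_mem hi)
    exact (Xnorm_add hN (hf a (Finset.mem_insert_self _ _)) (continuous_finsetSum s h1)).trans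
      (by linarith [ih h1])

/-- Integration formula. -/
lemma ftc01 {F F' : ℝ → ℝ} (hF : ContinuousOn F (Icc 0 1))
    (hd : ∀ z ∈ Ioo (0:ℝ) 1, HasDerivAt F (F' z) z) (hc : Continuous F') :
    ∫ z in (0:ℝ)..1, F' z = F 1 - F 0 :=
  intervalIntegral.integral_eq_sub_of_hasDerivAt_of_le zero_le_one hF hd (hc.intervalIntegrable _ _)

lemma rpow_split {z : ℝ} (hz : 0 < z) (q : ℝ) : z ^ q = z * z ^ (q - 1) := by
  rw [Real.rpow_sub_one hz.ne']; field_simp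

/-- Hardy inequality in `L²`. -/
lemma hardyX {N : ℝ} (hN : 4 ≤ N) (j : ℕ) (c : ℝ) (hc : j + N/2 < 2 * c) {h : ℝ → ℝ} (hh : Sm h) :
    Xnorm N (fun z => Real.sqrt z ^ j * h z)
      ≤ (2 / (2*c - (j + N/2))) *
        Xnorm N (fun z => Real.sqrt z ^ j * (z * deriv h z + c * h z)) := by
  set q : ℝ := j + N/2 with hq
  have hj : (0:ℝ) ≤ j := Nat.cast_nonneg j
  have hq1 : 1 ≤ q := by rw [hq]; linarith
  have hsq : Continuous Real.sqrt := Real.continuous_sqrt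
  have hhc : Continuous h := hh.continuous
  have hhd : Continuous (deriv h) := hh.der.continuous
  have c1 : Continuous (fun z => Real.sqrt z ^ j * h z) := by fun_prop
  have c2 : Continuous (fun z => Real.sqrt z ^ j * (z * deriv h z + c * h z)) := by fun_prop
  have key : ∫ z in (0:ℝ)..1, (q * z^(q-1) * (h z)^2 + z^q * (2 * h z * deriv h z)) = h 1 ^ 2 := by
    have cq : Continuous (fun z : ℝ => z ^ q) := Real.continuous_rpow_const (by linarith)
    have cq' : Continuous (fun z : ℝ => z ^ (q-1)) := Real.continuous_rpow_const (by linarith)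
    rw [ftc01 (F := fun z => z^q * (h z)^2)]
    · simp [Real.zero_rpow (show q ≠ 0 by linarith)]
    · exact (cq.mul (hhc.pow 2)).continuousOn
    · intro z hz
      have h1 := (Real.hasDerivAt_rpow_const (x := z) (p := q) (Or.inr hq1)).mul ((hh.hd z).pow 2)
      have h2 : HasDerivAt (fun z => z^q * (h z)^2) _ z := h1
      exact h2.congr_deriv (by simp)
    · fun_prop
  have e1 : ip N (fun z => Real.sqrt z ^ j * h z) (fun z => Real.sqrt z ^ j * (z * deriv h z + c * h z))
      = (1/2) * h 1 ^ 2 + (c - q/2) * ip N (fun z => Real.sqrt z ^ j * h z) (fun z => Real.sqrt z ^ j * h z) := by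
    have i1 : IntervalIntegrable (fun z : ℝ => (q * z^(q-1) * (h z)^2 + z^q * (2 * h z * deriv h z))) volume 0 1 := by
      have cq : Continuous (fun z : ℝ => z ^ q) := Real.continuous_rpow_const (by linarith)
      have cq' : Continuous (fun z : ℝ => z ^ (q-1)) := Real.continuous_rpow_const (by linarith)
      apply Continuous.intervalIntegrable; fun_prop
    rw [← key]
    unfold ip
    rw [← intervalIntegral.integral_const_mul, ← intervalIntegral.integral_const_mul,
      ← intervalIntegral.integral_add (i1.const_mul _) ((ip_int hN c1 c1).const_mul _)]
    apply intervalIntegral.integral_congr_ae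
    filter_upwards with z hz
    rw [uIoc_of_le zero_le_one] at hz
    have hw : Real.sqrt z ^ j * Real.sqrt z ^ j * z ^ (N/2-1) = z ^ (q-1) := by
      rw [← mul_pow, Real.mul_self_sqrt hz.1.le, ← Real.rpow_natCast, ← Real.rpow_add hz.1]
      congr 1; rw [hq]; ring
    rw [rpow_split hz.1 q, ← hw]; ring
  have e2 := (abs_le.1 (ip_cs hN c1 c2)).2
  rw [e1, ← Xnorm_sq] at e2
  set A := Xnorm N (fun z => Real.sqrt z ^ j * h z)
  set B := Xnorm N (fun z => Real.sqrt z ^ j * (z * deriv h z + c * h z))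
  have hA : 0 ≤ A := Xnorm_nonneg _ _
  have hB : 0 ≤ B := Xnorm_nonneg _ _
  have hpos : 0 < 2*c - q := by linarith
  rw [div_mul_eq_mul_div, le_div_iff₀ hpos]
  rcases hA.eq_or_lt with h0 | h0
  · rw [← h0]; linarith
  · have : A * (A * (2*c-q)) ≤ A * (2*B) := by nlinarith [sq_nonneg (h 1)]
    exact le_of_mul_le_mul_left this h0

lemma green {N : ℝ} (hN : 4 ≤ N) {g h : ℝ → ℝ} (hg : Sm g) (hh : Sm h) :
    ip N (Ddot g) (Ddot h) + ip N h (Del N g) = deriv g 1 * h 1 := by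
  have cw := wcont hN
  have cp : Continuous (fun z : ℝ => z ^ (N/2)) := Real.continuous_rpow_const (by linarith)
  have a1 := hg.der.continuous
  have a2 := hg.der.der.continuous
  have a3 := hh.continuous
  have a4 := hh.der.continuous
  have c1 : Continuous (Ddot g) := Real.continuous_sqrt.mul a1
  have c2 : Continuous (Ddot h) := Real.continuous_sqrt.mul a4
  have key := ftc01 (F := fun z => z^(N/2) * (deriv g z * h z))
    (F' := fun z => (N/2) * z^(N/2-1) * (deriv g z * h z)
      + z^(N/2) * (deriv (deriv g) z * h z + deriv g z * deriv h z))
    (by fun_prop) (fun z hz => by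
      have h1 := (Real.hasDerivAt_rpow_const (x := z) (p := N/2) (Or.inr (by linarith))).mul
        ((hg.der.hd z).mul (hh.hd z))
      exact h1) (by fun_prop)
  rw [show deriv g 1 * h 1 = (fun z : ℝ => z^(N/2) * (deriv g z * h z)) 1 - (fun z : ℝ => z^(N/2) * (deriv g z * h z)) 0 by
    simp [Real.zero_rpow (show N/2 ≠ 0 by linarith)], ← key]
  unfold ip
  rw [← intervalIntegral.integral_add (ip_int hN c1 c2) (ip_int hN a3 (hg.del N).continuous)]
  apply intervalIntegral.integral_congr_ae
  filter_upwards with z hz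
  rw [uIoc_of_le zero_le_one] at hz
  rw [rpow_split hz.1 (N/2)]
  unfold Ddot Del
  have := Real.mul_self_sqrt hz.1.le
  linear_combination (deriv g z * deriv h z * z ^ (N/2-1)) * this

lemma trace0 {N : ℝ} (hN : 4 ≤ N) {g : ℝ → ℝ} (hg : Sm g) :
    g 1 ^ 2 ≤ (N/2) * Xnorm N g ^ 2 + 2 * (Xnorm N g * Xnorm N (Ddot g)) := by
  have cw := wcont hN
  have cp : Continuous (fun z : ℝ => z ^ (N/2)) := Real.continuous_rpow_const (by linarith)
  have a1 := hg.der.continuous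
  have a3 := hg.continuous
  have c1 : Continuous (Ddot g) := Real.continuous_sqrt.mul a1
  have c2 : Continuous (fun z => Real.sqrt z * g z) := Real.continuous_sqrt.mul a3
  have key := ftc01 (F := fun z => z^(N/2) * (g z * g z))
    (F' := fun z => (N/2) * z^(N/2-1) * (g z * g z)
      + z^(N/2) * (deriv g z * g z + g z * deriv g z))
    (by fun_prop) (fun z hz => by
      have h1 := (Real.hasDerivAt_rpow_const (x := z) (p := N/2) (Or.inr (by linarith))).mul
        ((hg.hd z).mul (hg.hd z))
      exact h1) (by fun_prop)
  have e : g 1 ^ 2 = (N/2) * ip N g g + 2 * ip N (fun z => Real.sqrt z * g z) (Ddot g) := by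
    rw [show g 1 ^ 2 = (fun z : ℝ => z^(N/2) * (g z * g z)) 1 - (fun z : ℝ => z^(N/2) * (g z * g z)) 0 by
      simp [Real.zero_rpow (show N/2 ≠ 0 by linarith)]; ring, ← key]
    unfold ip
    rw [← intervalIntegral.integral_const_mul, ← intervalIntegral.integral_const_mul,
      ← intervalIntegral.integral_add ((ip_int hN a3 a3).const_mul _) ((ip_int hN c2 c1).const_mul _)]
    apply intervalIntegral.integral_congr_ae
    filter_upwards with z hz
    rw [uIoc_of_le zero_le_one] at hz
    rw [rpow_split hz.1 (N/2)]
    unfold Ddot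
    have := Real.mul_self_sqrt hz.1.le
    linear_combination (-2 * g z * deriv g z * z ^ (N/2-1)) * this
  rw [e, Xnorm_sq]
  have h1 := (abs_le.1 (ip_cs hN c2 c1)).2
  have h2 : Xnorm N (fun z => Real.sqrt z * g z) ≤ 1 * Xnorm N g :=
    Xnorm_mul_le hN Real.continuous_sqrt a3 fun z hz => by
      rw [abs_of_nonneg (Real.sqrt_nonneg _)]; exact Real.sqrt_le_one.2 hz.2
  have h3 := mul_le_mul_of_nonneg_right h2 (Xnorm_nonneg N (Ddot g))
  linarith

lemma trace1 {N : ℝ} (hN : 4 ≤ N) {g : ℝ → ℝ} (hg : Sm g) :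
    deriv g 1 ^ 2 ≤ 2 * (Xnorm N (Ddot g) * Xnorm N (Del N g)) := by
  have cw := wcont hN
  have cp : Continuous (fun z : ℝ => z ^ (N/2)) := Real.continuous_rpow_const (by linarith)
  have a1 := hg.der.continuous
  have a2 := hg.der.der.continuous
  have c1 : Continuous (Ddot g) := Real.continuous_sqrt.mul a1
  have c2 : Continuous (fun z => z^(N/2) * deriv g z) := cp.mul a1
  have c3 := (hg.del N).continuous
  have key := ftc01 (F := fun z => (z^(N/2) * deriv g z) * (z^(N/2) * deriv g z))
    (F' := fun z => ((N/2) * z^(N/2-1) * deriv g z + z^(N/2) * deriv (deriv g) z) * (z^(N/2) * deriv g z)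
      + (z^(N/2) * deriv g z) * ((N/2) * z^(N/2-1) * deriv g z + z^(N/2) * deriv (deriv g) z))
    (by fun_prop) (fun z hz => by
      have h1 := (Real.hasDerivAt_rpow_const (x := z) (p := N/2) (Or.inr (by linarith))).mul
        (hg.der.hd z)
      exact h1.mul h1) (by fun_prop)
  have e : deriv g 1 ^ 2 = 2 * ip N (fun z => z^(N/2) * deriv g z) (Del N g) := by
    rw [show deriv g 1 ^ 2 = (fun z : ℝ => (z^(N/2) * deriv g z) * (z^(N/2) * deriv g z)) 1 - (fun z : ℝ => (z^(N/2) * deriv g z) * (z^(N/2) * deriv g z)) 0 by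
      simp [Real.zero_rpow (show N/2 ≠ 0 by linarith)]; ring, ← key]
    unfold ip
    rw [← intervalIntegral.integral_const_mul]
    apply intervalIntegral.integral_congr_ae
    filter_upwards with z hz
    rw [uIoc_of_le zero_le_one] at hz
    rw [rpow_split hz.1 (N/2)]
    unfold Del
    ring
  rw [e]
  have h1 := (abs_le.1 (ip_cs hN c2 c3)).2
  have h2 : Xnorm N (fun z => z^(N/2) * deriv g z) ≤ Xnorm N (Ddot g) := by
    refine Xnorm_mono hN c2 c1 fun z hz => ?_
    unfold Ddot
    rw [abs_mul, abs_mul, abs_of_nonneg (Real.sqrt_nonneg _), abs_of_nonneg (Real.rpow_nonneg hz.1.le _)]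
    refine mul_le_mul_of_nonneg_right ?_ (abs_nonneg _)
    rw [Real.sqrt_eq_rpow]
    exact Real.rpow_le_rpow_of_exponent_ge hz.1 hz.2 (by linarith)
  have h3 := mul_le_mul_of_nonneg_right h2 (Xnorm_nonneg N (Del N g))
  linarith

lemma gnorm_nonneg (N : ℝ) (ℓ : ℕ) (f : ℝ → ℝ) : 0 ≤ gnorm N ℓ f := by
  rw [gnorm_eq]; exact Xnorm_nonneg _ _

lemma normN_nonneg (N : ℝ) (n : ℕ) (f : ℝ → ℝ) : 0 ≤ normN N n f := Real.sqrt_nonneg _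

lemma normN_sq (N : ℝ) (n : ℕ) (f : ℝ → ℝ) :
    normN N n f ^ 2 = ∑ ℓ ∈ Finset.range (n + 1), (gnorm N ℓ f) ^ 2 :=
  Real.sq_sqrt (Finset.sum_nonneg fun _ _ => sq_nonneg _)

lemma normN_succ_sq (N : ℝ) (n : ℕ) (f : ℝ → ℝ) :
    normN N (n+1) f ^ 2 = normN N n f ^ 2 + gnorm N (n+1) f ^ 2 := by
  rw [normN_sq, normN_sq, Finset.sum_range_succ]

lemma gnorm_le {N : ℝ} {ℓ n : ℕ} (h : ℓ ≤ n) (f : ℝ → ℝ) : gnorm N ℓ f ≤ normN N n f := by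
  apply le_of_sq_le_sq _ (normN_nonneg _ _ _)
  rw [normN_sq]
  exact Finset.single_le_sum (f := fun ℓ => gnorm N ℓ f ^ 2) (fun _ _ => sq_nonneg _)
    (Finset.mem_range.2 (by omega))

lemma normN_mono {N : ℝ} {m n : ℕ} (h : m ≤ n) (f : ℝ → ℝ) : normN N m f ≤ normN N n f := by
  apply Real.sqrt_le_sqrt
  apply Finset.sum_le_sum_of_subset_of_nonneg
  · intro i; simp only [Finset.mem_range]; omega
  · intros; positivity

lemma normN_succ_le (N : ℝ) (n : ℕ) (f : ℝ → ℝ) :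
    normN N (n+1) f ≤ normN N n f + gnorm N (n+1) f := by
  apply le_of_sq_le_sq _ (add_nonneg (normN_nonneg _ _ _) (gnorm_nonneg _ _ _))
  rw [normN_succ_sq]
  nlinarith [mul_nonneg (normN_nonneg N n f) (gnorm_nonneg N (n+1) f)]

lemma normN_le_of {N : ℝ} {n : ℕ} {f : ℝ → ℝ} {B : ℝ} (h : ∀ ℓ ≤ n, gnorm N ℓ f ≤ B) :
    normN N n f ≤ (n+1) * B := by
  have hB : 0 ≤ B := (gnorm_nonneg N 0 f).trans (h 0 (Nat.zero_le _))
  induction n with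
  | zero =>
    have : normN N 0 f = gnorm N 0 f := by
      unfold normN; simp [Real.sqrt_sq (gnorm_nonneg N 0 f)]
    rw [this]; simpa using h 0 le_rfl
  | succ n ih =>
    have := normN_succ_le N n f
    have := ih (fun ℓ hℓ => h ℓ (by omega))
    have := h (n+1) le_rfl
    push_cast; linarith

lemma interp_alg {N V v0 v2 T S a : ℝ} (hN : 4 ≤ N) (h0 : 0 ≤ v0) (h01 : v0 ≤ V) (h12 : V ≤ v2)
    (hTS : T^2 * S^2 ≤ (N+4) * V^2 * (v0*v2)) (hV : V^2 = v0^2 + a^2)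
    (ha : a^2 ≤ |T*S| + v0*v2) : V^2 ≤ (N+8) * (v0 * v2) := by
  have hP : 0 ≤ v0*v2 := mul_nonneg h0 (by linarith)
  have h1 : |T*S| ≤ (V^2 + (N+4)*(v0*v2))/2 := by
    apply abs_le_of_sq_le_sq
    · nlinarith [sq_nonneg (V^2 - (N+4)*(v0*v2))]
    · have := sq_nonneg V
      have : 0 ≤ (N+4)*(v0*v2) := mul_nonneg (by linarith) hP
      linarith
  have h2 : v0^2 ≤ v0*v2 := by nlinarith
  nlinarith

/-- Interpolation (log-convexity) of the graded norms. -/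
lemma interpX {N : ℝ} (hN : 4 ≤ N) (k : ℕ) {y : ℝ → ℝ} (hy : Sm y) :
    normN N (k+1) y ^ 2 ≤ (N+8) * (normN N k y * normN N (k+2) y) := by
  have n0 := normN_nonneg N k y
  have m1 : normN N k y ≤ normN N (k+1) y := normN_mono (by omega) y
  have m2 : normN N (k+1) y ≤ normN N (k+2) y := normN_mono (by omega) y
  have g0 : gnorm N k y ≤ normN N k y := gnorm_le le_rfl y
  have g1 : gnorm N (k+1) y ≤ normN N (k+1) y := gnorm_le le_rfl y
  have g2 : gnorm N (k+2) y ≤ normN N (k+2) y := gnorm_le le_rfl y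
  have p0 := gnorm_nonneg N k y
  have p1 := gnorm_nonneg N (k+1) y
  have p2 := gnorm_nonneg N (k+2) y
  have hs := normN_succ_sq N k y
  set v0 := normN N k y
  set V := normN N (k+1) y
  set v2 := normN N (k+2) y
  have q1 : 0 ≤ V := n0.trans m1
  have q2 : 0 ≤ v2 := q1.trans m2
  rcases Nat.even_or_odd' k with ⟨m, rfl | rfl⟩
  · have e0 : gnorm N (2*m) y = Xnorm N (DelIter N m y) := by rw [gnorm_eq, Lop_even]
    have e1 : gnorm N (2*m+1) y = Xnorm N (Ddot (DelIter N m y)) := by rw [gnorm_eq, Lop_odd]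
    have e2 : gnorm N (2*m+2) y = Xnorm N (Del N (DelIter N m y)) := by
      rw [gnorm_eq, show 2*m+2 = 2*(m+1) by ring, Lop_even]; rfl
    have hg := hy.delIter N m
    have t0 := trace0 hN hg
    have t1 := trace1 hN hg
    have gr := green hN hg hg
    have cs := ip_cs hN hg.continuous (hg.del N).continuous
    rw [← Xnorm_sq] at gr
    rw [← e0, ← e1] at t0
    rw [← e1, ← e2] at t1
    rw [← e0, ← e2] at cs
    rw [← e1] at gr
    refine interp_alg (T := deriv (DelIter N m y) 1) (S := DelIter N m y 1) hN n0 m1 m2 ?_ hs ?_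
    · have b1 : deriv (DelIter N m y) 1 ^ 2 ≤ 2 * (V * v2) := t1.trans (by gcongr)
      have b2 : DelIter N m y 1 ^ 2 ≤ (N/2+2) * (v0 * V) := by
        have : gnorm N (2*m) y ^ 2 ≤ v0 * V := by rw [pow_two]; gcongr; linarith
        have : gnorm N (2*m) y * gnorm N (2*m+1) y ≤ v0 * V := by gcongr
        nlinarith
      calc _ ≤ (2 * (V * v2)) * ((N/2+2) * (v0 * V)) := by gcongr
        _ = _ := by ring
    · have := le_abs_self (deriv (DelIter N m y) 1 * DelIter N m y 1)
      have := (abs_le.1 cs).1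
      have : gnorm N (2*m) y * gnorm N (2*m+2) y ≤ v0 * v2 := by gcongr
      linarith
  · have e0 : gnorm N (2*m+1) y = Xnorm N (Ddot (DelIter N m y)) := by rw [gnorm_eq, Lop_odd]
    have e1 : gnorm N (2*m+1+1) y = Xnorm N (Del N (DelIter N m y)) := by
      rw [gnorm_eq, show 2*m+1+1 = 2*(m+1) by ring, Lop_even]; rfl
    have e2 : gnorm N (2*m+1+2) y = Xnorm N (Ddot (Del N (DelIter N m y))) := by
      rw [gnorm_eq, show 2*m+1+2 = 2*(m+1)+1 by ring, Lop_odd]; rfl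
    have hg := hy.delIter N m
    have hh := hg.del N
    have t0 := trace0 hN hh
    have t1 := trace1 hN hg
    have gr := green hN hg hh
    have cs := ip_cs hN (f := Ddot (DelIter N m y)) (g := Ddot (Del N (DelIter N m y)))
      (Real.continuous_sqrt.mul hg.der.continuous) (Real.continuous_sqrt.mul hh.der.continuous)
    rw [← Xnorm_sq] at gr
    rw [← e1, ← e2] at t0
    rw [← e0, ← e1] at t1
    rw [← e0, ← e2] at cs
    rw [← e1] at gr
    refine interp_alg (T := deriv (DelIter N m y) 1) (S := Del N (DelIter N m y) 1) hN n0 m1 m2 ?_ hs ?_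
    · have b1 : deriv (DelIter N m y) 1 ^ 2 ≤ 2 * (v0 * V) := t1.trans (by gcongr)
      have b2 : Del N (DelIter N m y) 1 ^ 2 ≤ (N/2+2) * (V * v2) := by
        have : gnorm N (2*m+1+1) y ^ 2 ≤ V * v2 := by rw [pow_two]; gcongr; linarith
        have : gnorm N (2*m+1+1) y * gnorm N (2*m+1+2) y ≤ V * v2 := by gcongr
        nlinarith
      calc _ ≤ (2 * (v0 * V)) * ((N/2+2) * (V * v2)) := by gcongr
        _ = _ := by ring
    · have := le_abs_self (deriv (DelIter N m y) 1 * Del N (DelIter N m y) 1)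
      have := (abs_le.1 cs).1
      have : gnorm N (2*m+1) y * gnorm N (2*m+1+2) y ≤ v0 * v2 := by gcongr
      linarith

/-- Log-convex sequences (up to a constant) are bounded by their end values. -/
lemma chain {K : ℝ} (hK : 1 < K) (m : ℕ) (w : ℕ → ℝ) (hw : ∀ i, 0 ≤ w i)
    (h : ∀ i, i + 2 ≤ m → w (i+1) ^ 2 ≤ K * (w i * w (i+2))) (i : ℕ) (hi : i ≤ m) :
    w i ≤ K ^ (m*m) * (w 0 + w m) := by
  have hK0 : 0 < K := by linarith
  let W : ℕ → ℝ := fun i => w i / K ^ (i * (m-i))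
  have hW : ∀ i, 0 ≤ W i := fun i => div_nonneg (hw i) (by positivity)
  obtain ⟨a, ha, hmax⟩ := Finset.exists_max_image (Finset.range (m+1)) W ⟨0, by simp⟩
  have ham : a ≤ m := by have := Finset.mem_range.1 ha; omega
  have hWa : W a ≤ w 0 + w m := by
    rcases Nat.eq_zero_or_pos a with rfl | h0
    · simp only [W, zero_mul, pow_zero, div_one]; linarith [hw m]
    rcases ham.eq_or_lt with rfl | h1
    · simp only [W, Nat.sub_self, mul_zero, pow_zero, div_one]; linarith [hw 0]
    obtain ⟨c, rfl⟩ : ∃ c, a = c + 1 := ⟨a - 1, by omega⟩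
    obtain ⟨d, rfl⟩ : ∃ d, m = c + 2 + d := ⟨m - (c+2), by omega⟩
    have h2 := h c (by omega)
    have m0 := hmax c (by simp; omega)
    have m2 := hmax (c+2) (by simp)
    have x0 : w c = W c * K ^ (c * (d+2)) := by
      simp only [W]; rw [show c + 2 + d - c = d+2 by omega]; field_simp
    have x1 : w (c+1) = W (c+1) * K ^ ((c+1) * (d+1)) := by
      simp only [W]; rw [show c + 2 + d - (c+1) = d+1 by omega]; field_simp
    have x2 : w (c+2) = W (c+2) * K ^ ((c+2) * d) := by
      simp only [W]; rw [show c + 2 + d - (c+2) = d by omega]; field_simp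
    rw [x0, x1, x2] at h2
    have h3 : W (c+1) ^ 2 * K ^ (2 * ((c+1)*(d+1))) ≤ (W c * W (c+2)) * K ^ (2 * ((c+1)*(d+1)) - 1) := by
      rw [show 2 * ((c+1)*(d+1)) - 1 = 1 + c * (d+2) + (c+2)*d by
        have : 2 * ((c+1)*(d+1)) = 1 + c * (d+2) + (c+2)*d + 1 := by ring
        omega]
      calc _ = (W (c + 1) * K ^ ((c + 1) * (d + 1))) ^ 2 := by ring
        _ ≤ _ := h2
        _ = _ := by ring
    have h4 : W c * W (c+2) ≤ W (c+1) ^ 2 := by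
      rw [pow_two]; exact mul_le_mul m0 m2 (hW _) (hW _)
    obtain ⟨e, he⟩ : ∃ e, 2 * ((c+1)*(d+1)) = e + 1 := ⟨2 * ((c+1)*(d+1)) - 1, by
      have : 0 < (c+1)*(d+1) := by positivity
      omega⟩
    rw [he, Nat.add_sub_cancel, pow_succ K e] at h3
    have hKe : 0 < K ^ e := by positivity
    have h5 : W (c+1)^2 * K ≤ W (c+1)^2 := by
      have : (W (c+1)^2 * K) * K^e ≤ W (c+1)^2 * K^e := by nlinarith
      exact le_of_mul_le_mul_right this hKe
    have h6 : W (c+1) ^ 2 ≤ 0 := by nlinarith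
    have h7 : W (c+1) = 0 := by nlinarith [hW (c+1)]
    rw [h7]; linarith [hw 0, hw (c+2+d)]
  have h8 : w i = W i * K ^ (i * (m-i)) := by simp only [W]; field_simp
  have h9 := hmax i (by simp; omega)
  rw [h8, mul_comm]
  have h10 : K ^ (i * (m-i)) ≤ K ^ (m*m) :=
    pow_le_pow_right₀ hK.le (Nat.mul_le_mul hi (Nat.sub_le _ _))
  exact mul_le_mul h10 (h9.trans hWa) (hW _) (by positivity)

/-- Abstract control of all monomial operators of order `r` by the graded operators. -/
lemma absS (N : ℝ) (Bd : (ℝ → ℝ) → ℝ → Prop)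
    (H0 : ∀ f g A, Continuous f → Continuous g → (∀ z ∈ Ioc (0:ℝ) 1, f z = g z) → Bd f A → Bd g A)
    (H1 : ∀ f g c A B, Continuous f → Continuous g → Bd f A → Bd g B →
      Bd (fun z => f z + c * g z) (A + |c| * B))
    (H2 : ∀ r k : ℕ, 2 ≤ r → r ≤ 2 * k → ∃ K ≥ (0:ℝ), ∀ h, Sm h → ∀ A,
      Bd (fun z => Real.sqrt z ^ (2*k-r) * (z * deriv h z + (N/2+((k:ℝ)-1)) * h z)) A →
      Bd (fun z => Real.sqrt z ^ (2*k-r) * h z) (K * A)) :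
    ∀ r k : ℕ, k ≤ r → r ≤ 2*k → ∃ C ≥ (0:ℝ), ∀ y, Sm y → ∀ A, (∀ ℓ ≤ r, Bd (Lop N ℓ y) A) →
      Bd (fun z => Real.sqrt z ^ (2*k-r) * iteratedDeriv k y z) (C * A) := by
  intro r
  induction r using Nat.twoStepInduction with
  | zero =>
    intro k h1 h2
    obtain rfl : k = 0 := by omega
    refine ⟨1, by norm_num, fun y hy A hA => ?_⟩
    have := hA 0 le_rfl
    simpa [Lop_zero] using this
  | one =>
    intro k h1 h2
    obtain rfl : k = 1 := by omega
    refine ⟨1, by norm_num, fun y hy A hA => ?_⟩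
    have := hA 1 le_rfl
    rw [Lop_one] at this
    have h3 : Bd (fun z => Real.sqrt z * deriv y z) A := this
    simpa using h3
  | more r ih _ =>
    have small : ∀ k : ℕ, k < r + 2 → r + 2 ≤ 2*k → ∃ C ≥ (0:ℝ), ∀ y, Sm y → ∀ A,
        (∀ ℓ ≤ r+2, Bd (Lop N ℓ y) A) →
        Bd (fun z => Real.sqrt z ^ (2*k-(r+2)) * iteratedDeriv k y z) (C * A) := by
      intro k h1 h2
      obtain ⟨k, rfl⟩ : ∃ i, k = i + 1 := ⟨k-1, by omega⟩
      obtain ⟨C, hC, hC'⟩ := ih k (by omega) (by omega)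
      obtain ⟨K, hK, hK'⟩ := H2 (r+2) (k+1) (by omega) (by omega)
      refine ⟨K * C, by positivity, fun y hy A hA => ?_⟩
      have h3 := hC' (Del N y) (hy.del N) A (fun ℓ hℓ => by
        rw [← Lop_add_two]; exact hA _ (by omega))
      rw [mul_assoc]
      apply hK' _ (hy.iter (k+1))
      have e : 2*(k+1)-(r+2) = 2*k-r := by omega
      rw [e]
      refine H0 _ _ _ (cont_mono (hy.del N) _ _) ?_ (fun z hz => ?_) h3
      · have := (hy.iter (k+1)).continuous
        have := (hy.iter (k+1)).der.continuous
        have := Real.continuous_sqrt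
        fun_prop
      · rw [iter_del hy, ← iteratedDeriv_succ]; push_cast; ring
    intro k h1 h2
    rcases h1.lt_or_eq with h1 | rfl
    · exact small k h1 h2
    obtain ⟨C, hC, hC'⟩ := ih r le_rfl (by omega)
    obtain ⟨D, hD, hD'⟩ := small (r+1) (by omega) (by omega)
    refine ⟨C + |(-(N/2+r))| * D, by positivity, fun y hy A hA => ?_⟩
    have h3 := hC' (Del N y) (hy.del N) A (fun ℓ hℓ => by
      rw [← Lop_add_two]; exact hA _ (by omega))
    have h4 := hD' y hy A hA
    have e : (C + |(-(N/2+r))| * D) * A = C * A + |(-(N/2+r))| * (D * A) := by ring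
    rw [e]
    have h5 := H1 _ _ (-(N/2+r)) _ _ (cont_mono (hy.del N) _ _) (cont_mono hy _ _) h3 h4
    refine H0 _ _ _ ?_ (cont_mono hy _ _) (fun z hz => ?_) h5
    · exact (cont_mono (hy.del N) _ _).add (continuous_const.mul (cont_mono hy _ _))
    · simp only [iter_del hy]
      have e1 : 2*(r+1)-(r+2) = r := by omega
      have e2 : 2*r - r = r := by omega
      have e3 : 2*(r+2)-(r+2) = r + 2 := by omega
      rw [e1, e2, e3, pow_add, Real.sq_sqrt hz.1.le]; ring

lemma monoX {N : ℝ} (hN : 4 ≤ N) (r k : ℕ) (h1 : k ≤ r) (h2 : r ≤ 2*k) :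
    ∃ C ≥ (0:ℝ), ∀ y, Sm y →
      Xnorm N (fun z => Real.sqrt z ^ (2*k-r) * iteratedDeriv k y z) ≤ C * normN N r y := by
  obtain ⟨C, hC, hC'⟩ := absS N (fun f A => Continuous f → Xnorm N f ≤ A)
    (fun f g A hf hg he h _ => (Xnorm_congr hN hf hg he) ▸ h hf)
    (fun f g c A B hf hg hA hB _ => by
      have h0 : Continuous (fun z => c * g z) := continuous_const.mul hg
      refine (Xnorm_add hN hf h0).trans ?_
      rw [Xnorm_smul]
      have := hA hf
      have := mul_le_mul_of_nonneg_left (hB hg) (abs_nonneg c)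
      linarith)
    (fun r k hr hk => by
      have hr' : (2:ℝ) ≤ r := by exact_mod_cast hr
      have hc : ((2*k-r : ℕ):ℝ) + N/2 < 2 * (N/2+((k:ℝ)-1)) := by
        rw [Nat.cast_sub hk]; push_cast; linarith
      refine ⟨2 / (2*(N/2+((k:ℝ)-1)) - (((2*k-r : ℕ):ℝ) + N/2)), ?_, fun h hh A hA _ => ?_⟩
      · exact div_nonneg (by norm_num) (by linarith)
      · refine (hardyX hN (2*k-r) (N/2+((k:ℝ)-1)) hc hh).trans ?_
        refine mul_le_mul_of_nonneg_left (hA ?_) (div_nonneg (by norm_num) (by linarith))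
        have := hh.continuous
        have := hh.der.continuous
        have := Real.continuous_sqrt
        fun_prop) r k h1 h2
  refine ⟨C, hC, fun y hy => hC' y hy _ (fun ℓ hℓ _ => ?_) (cont_mono hy _ _)⟩
  rw [← gnorm_eq]; exact gnorm_le hℓ y

lemma hardy_sup_aux (c : ℝ) (j : ℕ) (hc : (j:ℝ)/2 < c) {h : ℝ → ℝ} (hh : Sm h) (A : ℝ)
    (hA : ∀ z ∈ Ioc (0:ℝ) 1, Real.sqrt z ^ j * (z * deriv h z + c * h z) ≤ A) :
    ∀ z ∈ Ioc (0:ℝ) 1, Real.sqrt z ^ j * h z ≤ A / (c - j/2) := by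
  have hj : (0:ℝ) ≤ j := Nat.cast_nonneg j
  have hc0 : 0 < c := by linarith
  have hd : 0 < c - j/2 := by linarith
  set d := c - (j:ℝ)/2 with hdd
  have hs : ∀ z : ℝ, 0 < z → Real.sqrt z ^ j = z ^ ((j:ℝ)/2) := fun z hz => by
    rw [Real.sqrt_eq_rpow, ← Real.rpow_natCast, ← Real.rpow_mul hz.le]; congr 1; ring
  have hdv : ∀ z ∈ Ioo (0:ℝ) 1, HasDerivAt (fun z => A * z^d / d - z^c * h z)
      (A * (d * z^(d-1)) / d - (c * z^(c-1) * h z + z^c * deriv h z)) z := fun z hz =>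
    (((Real.hasDerivAt_rpow_const (Or.inl hz.1.ne')).const_mul A).div_const d).sub
      ((Real.hasDerivAt_rpow_const (Or.inl hz.1.ne')).mul (hh.hd z))
  have hm : MonotoneOn (fun z => A * z^d / d - z^c * h z) (Icc (0:ℝ) 1) := by
    apply monotoneOn_of_deriv_nonneg (convex_Icc 0 1)
    · have c1 : Continuous (fun z : ℝ => z ^ d) := Real.continuous_rpow_const hd.le
      have c2 : Continuous (fun z : ℝ => z ^ c) := Real.continuous_rpow_const hc0.le
      have c3 := hh.continuous
      exact (((continuous_const.mul c1).div_const d).sub (c2.mul c3)).continuousOn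
    · rw [interior_Icc]
      exact fun z hz => (hdv z hz).differentiableAt.differentiableWithinAt
    · rw [interior_Icc]
      intro z hz
      rw [(hdv z hz).deriv]
      have h1 := hA z ⟨hz.1, hz.2.le⟩
      rw [hs z hz.1] at h1
      have h2 : z^(c-1) = z^(d-1) * z^((j:ℝ)/2) := by
        rw [← Real.rpow_add hz.1]; congr 1; rw [hdd]; ring
      have h3 : A * (d * z^(d-1)) / d = A * z^(d-1) := by field_simp
      rw [h3, rpow_split hz.1 c, h2]
      have h4 : 0 < z^(d-1) := Real.rpow_pos_of_pos hz.1 _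
      nlinarith
  intro z hz
  have h1 := hm ⟨le_rfl, zero_le_one⟩ ⟨hz.1.le, hz.2⟩ hz.1.le
  simp only [Real.zero_rpow hd.ne', Real.zero_rpow hc0.ne'] at h1
  have h2 : z^c = z^d * z^((j:ℝ)/2) := by
    rw [← Real.rpow_add hz.1]; congr 1; rw [hdd]; ring
  rw [h2] at h1
  rw [hs z hz.1, le_div_iff₀ hd]
  have h4 : 0 < z^d := Real.rpow_pos_of_pos hz.1 _
  have h5 : A * z^d / d * d = A * z^d := by field_simp
  have h1' : (0:ℝ) ≤ A * z^d / d - z^d * z^((j:ℝ)/2) * h z := by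
    simpa only [mul_zero, zero_div, zero_mul, sub_zero] using h1
  have h7 := sub_nonneg.1 h1'
  have h8 := mul_le_mul_of_nonneg_right h7 hd.le
  rw [h5] at h8
  have h6 : z^d * (z^((j:ℝ)/2) * h z * d) ≤ z^d * A := by
    rw [← mul_assoc, ← mul_assoc, mul_comm _ A]; exact h8
  exact le_of_mul_le_mul_left h6 h4

lemma hardy_sup (c : ℝ) (j : ℕ) (hc : (j:ℝ)/2 < c) {h : ℝ → ℝ} (hh : Sm h) (A : ℝ)
    (hA : ∀ z ∈ Ioc (0:ℝ) 1, |Real.sqrt z ^ j * (z * deriv h z + c * h z)| ≤ A) :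
    ∀ z ∈ Ioc (0:ℝ) 1, |Real.sqrt z ^ j * h z| ≤ (1 / (c - j/2)) * A := by
  intro z hz
  rw [one_div_mul_eq_div]
  refine abs_le.2 ⟨?_, hardy_sup_aux c j hc hh A (fun z hz => (abs_le.1 (hA z hz)).2) z hz⟩
  have hn : Sm (fun z => - h z) := ContDiff.neg hh
  have := hardy_sup_aux c j hc hn A (fun z hz => by
    have h1 := (abs_le.1 (hA z hz)).1
    rw [deriv.fun_neg]; linarith) z hz
  linarith

lemma monoSup (r k : ℕ) (h1 : k ≤ r) (h2 : r ≤ 2*k) :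
    ∃ C ≥ (0:ℝ), ∀ y, Sm y → ∀ A, (∀ ℓ ≤ r, ∀ z ∈ Ioc (0:ℝ) 1, |Lop 1 ℓ y z| ≤ A) →
      ∀ z ∈ Ioc (0:ℝ) 1, |Real.sqrt z ^ (2*k-r) * iteratedDeriv k y z| ≤ C * A :=
  absS 1 (fun f A => ∀ z ∈ Ioc (0:ℝ) 1, |f z| ≤ A)
    (fun f g A _ _ he h z hz => he z hz ▸ h z hz)
    (fun f g c A B _ _ hA hB z hz => by
      refine (abs_add_le _ _).trans ?_
      rw [abs_mul]
      have := hA z hz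
      have := mul_le_mul_of_nonneg_left (hB z hz) (abs_nonneg c)
      linarith)
    (fun r k hr hk => by
      have hr' : (2:ℝ) ≤ r := by exact_mod_cast hr
      have hc : ((2*k-r : ℕ):ℝ)/2 < 1/2+((k:ℝ)-1) := by
        rw [Nat.cast_sub hk]; push_cast; linarith
      exact ⟨1 / ((1/2+((k:ℝ)-1)) - ((2*k-r : ℕ):ℝ)/2), div_nonneg (by norm_num) (by linarith),
        fun h hh A hA => hardy_sup _ _ hc hh A hA⟩) r k h1 h2

lemma lop1_diff {b : ℝ → ℝ} (hb : Sm b) (ℓ : ℕ) {z : ℝ} (hz : 0 < z) :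
    DifferentiableAt ℝ (Lop 1 ℓ b) z := by
  unfold Lop
  split_ifs
  · exact ((hb.delIter 1 _).hd z).differentiableAt
  · exact (Real.hasDerivAt_sqrt hz.ne').differentiableAt.mul
      ((hb.delIter 1 _).der.hd z).differentiableAt

lemma lop1_succ {b : ℝ → ℝ} (hb : Sm b) (ℓ : ℕ) {z : ℝ} (hz : 0 < z) :
    Ddot (Lop 1 ℓ b) z = Lop 1 (ℓ+1) b z := by
  rcases Nat.even_or_odd' ℓ with ⟨m, rfl | rfl⟩
  · rw [Lop_even, Lop_odd]
  · rw [Lop_odd, show 2*m+1+1 = 2*(m+1) by ring, Lop_even]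
    have hg := hb.delIter 1 m
    have h1 := (Real.hasDerivAt_sqrt hz.ne').mul (hg.der.hd z)
    have h2 : HasDerivAt (Ddot (DelIter 1 m b)) _ z := h1
    show Real.sqrt z * deriv (Ddot (DelIter 1 m b)) z = Del 1 (DelIter 1 m b) z
    rw [h2.deriv]
    unfold Del
    have h3 := Real.mul_self_sqrt hz.le
    have h4 : 0 < Real.sqrt z := Real.sqrt_pos.2 hz
    field_simp
    rw [Real.sq_sqrt hz.le]; ring

lemma ddot_iter {b : ℝ → ℝ} (hb : Sm b) (ℓ : ℕ) {z : ℝ} (hz : 0 < z) :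
    Ddot^[ℓ] b z = Lop 1 ℓ b z := by
  induction ℓ generalizing z with
  | zero => simp [Lop_zero]
  | succ ℓ ih =>
    rw [Function.iterate_succ_apply', ← lop1_succ hb ℓ hz]
    have : Ddot^[ℓ] b =ᶠ[nhds z] Lop 1 ℓ b :=
      Filter.eventually_of_mem (Ioi_mem_nhds hz) fun x hx => ih hx
    unfold Ddot at this ⊢
    rw [this.deriv_eq]

lemma ddot_iter_zero (b : ℝ → ℝ) (ℓ : ℕ) : Ddot^[ℓ+1] b 0 = 0 := by
  rw [Function.iterate_succ_apply']; simp [Ddot]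

lemma ddot_bdd {b : ℝ → ℝ} (hb : Sm b) (ℓ : ℕ) :
    BddAbove (Set.range fun z : Icc (0:ℝ) 1 => |Ddot^[ℓ] b z.1|) := by
  obtain ⟨C, hC⟩ := isCompact_Icc.exists_bound_of_continuousOn (s := Icc (0:ℝ) 1)
    (hb.lopc 1 ℓ).continuousOn
  refine ⟨C, ?_⟩
  rintro _ ⟨⟨z, hz⟩, rfl⟩
  rcases hz.1.eq_or_lt with h | h
  · subst h
    have h1 := hC 0 hz
    cases ℓ with
    | zero => simpa [Lop_zero] using h1
    | succ ℓ => simp only [ddot_iter_zero, abs_zero]; exact (norm_nonneg _).trans h1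
  · simp only [ddot_iter hb ℓ h]; exact hC z hz

lemma le_supN {b : ℝ → ℝ} (hb : Sm b) (ℓ : ℕ) {z : ℝ} (hz : z ∈ Icc (0:ℝ) 1) :
    |Ddot^[ℓ] b z| ≤ supN (Ddot^[ℓ] b) := le_ciSup (ddot_bdd hb ℓ) ⟨z, hz⟩

lemma supN_nonneg (f : ℝ → ℝ) : 0 ≤ supN f := Real.iSup_nonneg fun _ => abs_nonneg _

lemma supLow_nonneg (n : ℕ) (f : ℝ → ℝ) : 0 ≤ supLow n f :=
  Finset.sum_nonneg fun _ _ => supN_nonneg _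

lemma supLow_mono {m n : ℕ} (h : m ≤ n) (f : ℝ → ℝ) : supLow m f ≤ supLow n f := by
  apply Finset.sum_le_sum_of_subset_of_nonneg
  · intro i; simp only [Finset.mem_range]; omega
  · intros; exact supN_nonneg _

lemma supN_le_supLow {ℓ n : ℕ} (h : ℓ ≤ n) (f : ℝ → ℝ) : supN (Ddot^[ℓ] f) ≤ supLow n f :=
  Finset.single_le_sum (f := fun ℓ => supN (Ddot^[ℓ] f)) (fun _ _ => supN_nonneg _)
    (Finset.mem_range.2 (by omega))

lemma monoB (r k : ℕ) (h1 : k ≤ r) (h2 : r ≤ 2*k) :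
    ∃ C ≥ (0:ℝ), ∀ b, Sm b → ∀ z ∈ Ioc (0:ℝ) 1,
      |Real.sqrt z ^ (2*k-r) * iteratedDeriv k b z| ≤ C * supLow r b := by
  obtain ⟨C, hC, h⟩ := monoSup r k h1 h2
  refine ⟨C, hC, fun b hb => h b hb _ fun ℓ hℓ z hz => ?_⟩
  rw [← ddot_iter hb ℓ hz.1]
  exact (le_supN hb ℓ ⟨hz.1.le, hz.2⟩).trans (supN_le_supLow hℓ b)

lemma ddot_hd {b : ℝ → ℝ} (hb : Sm b) (ℓ : ℕ) {x : ℝ} (hx : 0 < x) :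
    HasDerivAt (fun x => Ddot^[ℓ] b (x^2/4)) (Ddot^[ℓ+1] b (x^2/4)) x := by
  have hz : 0 < x^2/4 := by positivity
  have he : Ddot^[ℓ] b =ᶠ[nhds (x^2/4)] Lop 1 ℓ b :=
    Filter.eventually_of_mem (Ioi_mem_nhds hz) fun x hx => ddot_iter hb ℓ hx
  have h1 : HasDerivAt (Ddot^[ℓ] b) (deriv (Ddot^[ℓ] b) (x^2/4)) (x^2/4) :=
    (he.symm.differentiableAt_iff.1 (lop1_diff hb ℓ hz)).hasDerivAt
  have h2 : HasDerivAt (fun x : ℝ => x^2/4) (x/2) x := by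
    have := ((hasDerivAt_id x).pow 2).div_const 4
    refine HasDerivAt.congr_deriv this ?_
    simp; ring
  have h3 := h1.comp x h2
  refine HasDerivAt.congr_deriv h3 ?_
  rw [Function.iterate_succ_apply']
  have : Real.sqrt (x^2/4) = x/2 := by
    rw [show x^2/4 = (x/2)^2 by ring, Real.sqrt_sq (by linarith)]
  unfold Ddot at *
  rw [this]; ring

/-- Landau's inequality. -/
lemma landau {b : ℝ → ℝ} (hb : Sm b) (ℓ : ℕ) :
    supN (Ddot^[ℓ+1] b) ^ 2
      ≤ 8 * (supN (Ddot^[ℓ] b) * (supN (Ddot^[ℓ] b) + supN (Ddot^[ℓ+2] b))) := by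
  have hA0 := supN_nonneg (Ddot^[ℓ] b)
  have hB0 := supN_nonneg (Ddot^[ℓ+2] b)
  set A := supN (Ddot^[ℓ] b) with hA
  set B := supN (Ddot^[ℓ+2] b) with hB
  have main : ∀ x ∈ Ioc (0:ℝ) 2, ∀ h ∈ Ioc (0:ℝ) 1,
      |Ddot^[ℓ+1] b (x^2/4)| * h ≤ 2 * A + h^2 * B := by
    intro x hx h hh
    have hz : ∀ t ∈ Ioc (0:ℝ) 2, t^2/4 ∈ Icc (0:ℝ) 1 := fun t ht =>
      ⟨by positivity, by nlinarith [ht.1, ht.2]⟩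
    obtain ⟨p, hp0, hp1, hp2⟩ : ∃ p, 0 < p ∧ p + h ≤ 2 ∧ (x = p ∨ x = p + h) := by
      by_cases hx1 : x ≤ 1
      · exact ⟨x, hx.1, by linarith [hh.2], Or.inl rfl⟩
      · exact ⟨x - h, by linarith [hh.2], by linarith [hx.2], Or.inr (by ring)⟩
    have hin : ∀ t ∈ Icc p (p+h), t ∈ Ioc (0:ℝ) 2 := fun t ht =>
      ⟨by linarith [ht.1], by linarith [ht.2]⟩
    obtain ⟨ξ, hξ, hξ'⟩ := exists_hasDerivAt_eq_slope (fun x => Ddot^[ℓ] b (x^2/4))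
      (fun x => Ddot^[ℓ+1] b (x^2/4)) (show p < p + h by linarith [hh.1])
      (fun t ht => (ddot_hd hb ℓ (hin t ht).1).continuousAt.continuousWithinAt)
      (fun t ht => ddot_hd hb ℓ (hin t ⟨ht.1.le, ht.2.le⟩).1)
    have hxm : x ∈ Icc p (p+h) := by
      rcases hp2 with rfl | rfl
      · exact ⟨le_rfl, by linarith [hh.1]⟩
      · exact ⟨by linarith [hh.1], le_rfl⟩
    have hξm : ξ ∈ Icc p (p+h) := ⟨hξ.1.le, hξ.2.le⟩
    have h2 := (convex_Icc p (p+h)).norm_image_sub_le_of_norm_hasDerivWithin_le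
      (f := fun x => Ddot^[ℓ+1] b (x^2/4)) (f' := fun x => Ddot^[ℓ+2] b (x^2/4)) (C := B)
      (fun t ht => (ddot_hd hb (ℓ+1) (hin t ht).1).hasDerivWithinAt)
      (fun t ht => le_supN hb (ℓ+2) (hz t (hin t ht))) hξm hxm
    have h3 : ‖x - ξ‖ ≤ h := abs_le.2 ⟨by linarith [hxm.1, hξm.2], by linarith [hxm.2, hξm.1]⟩
    have h4 : |Ddot^[ℓ+1] b (ξ^2/4)| * h ≤ 2 * A := by
      simp only [add_sub_cancel_left] at hξ'
      rw [hξ', abs_div, abs_of_pos hh.1, div_mul_cancel₀ _ hh.1.ne']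
      have u1 := le_supN hb ℓ (hz _ (hin (p+h) ⟨by linarith [hh.1], le_rfl⟩))
      have u2 := le_supN hb ℓ (hz _ (hin p ⟨le_rfl, by linarith [hh.1]⟩))
      have := abs_sub (Ddot^[ℓ] b ((p+h)^2/4)) (Ddot^[ℓ] b (p^2/4))
      linarith
    have h5 : |Ddot^[ℓ+1] b (x^2/4)| ≤ |Ddot^[ℓ+1] b (ξ^2/4)| + B * h := by
      have h6 := abs_sub_abs_le_abs_sub (Ddot^[ℓ+1] b (x^2/4)) (Ddot^[ℓ+1] b (ξ^2/4))
      simp only [Real.norm_eq_abs] at h2 h3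
      have := mul_le_mul_of_nonneg_left h3 hB0
      linarith
    nlinarith [hh.1]
  have key : ∀ s : ℝ, 0 ≤ s → (∀ h ∈ Ioc (0:ℝ) 1, s * h ≤ 2 * A + h^2 * B) → s^2 ≤ 8 * (A * (A+B)) := by
    intro s hs H
    rcases hs.eq_or_lt with rfl | hs
    · have : 0 ≤ A * (A+B) := by positivity
      linarith
    have h1 := H 1 ⟨one_pos, le_rfl⟩
    have hS : 0 < A + B := by nlinarith
    have h2 := H (s / (2*(A+B))) ⟨by positivity, by rw [div_le_one (by positivity)]; linarith⟩
    set S := A + B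
    have h3 : s * (s / (2*S)) = s^2 / (2*S) := by ring
    have h4 : (s / (2*S))^2 * B ≤ s^2 / (4*S) := by
      have : (s / (2*S))^2 * B ≤ (s / (2*S))^2 * S := by
        apply mul_le_mul_of_nonneg_left _ (sq_nonneg _); simp only [S]; linarith
      refine this.trans (le_of_eq ?_)
      field_simp; norm_num
    have h5 : s^2 / (2*S) = 2 * (s^2 / (4*S)) := by field_simp; norm_num
    have h6 : s^2 / (4*S) ≤ 2 * A := by linarith
    rw [div_le_iff₀ (by positivity)] at h6
    linarith
  have hle : supN (Ddot^[ℓ+1] b) ≤ Real.sqrt (8 * (A * (A+B))) := by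
    apply Real.iSup_le _ (Real.sqrt_nonneg _)
    rintro ⟨z, hz⟩
    apply Real.le_sqrt_of_sq_le
    rcases hz.1.eq_or_lt with h | h
    · subst h
      simp only [ddot_iter_zero]
      have : 0 ≤ A * (A+B) := by positivity
      simpa using this
    · have hx : 2 * Real.sqrt z ∈ Ioc (0:ℝ) 2 :=
        ⟨by have := Real.sqrt_pos.2 h; linarith, by have := Real.sqrt_le_one.2 hz.2; linarith⟩
      have h1 := main _ hx
      have e : (2 * Real.sqrt z)^2/4 = z := by rw [mul_pow, Real.sq_sqrt hz.1]; ring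
      rw [e] at h1
      exact key _ (abs_nonneg _) h1
  calc _ ≤ (Real.sqrt (8 * (A * (A+B))))^2 := by
        apply pow_le_pow_left₀ (supN_nonneg _) hle
    _ = _ := Real.sq_sqrt (by positivity)

/-- The right side of the commutator estimate. -/
noncomputable def RS (N : ℝ) (r : ℕ) (b g : ℝ → ℝ) : ℝ :=
  ∑ j ∈ Finset.Icc 1 r, supLow j b * normN N (r-j) g

lemma RS_nonneg (N : ℝ) (r : ℕ) (b g : ℝ → ℝ) : 0 ≤ RS N r b g :=
  Finset.sum_nonneg fun _ _ => mul_nonneg (supLow_nonneg _ _) (normN_nonneg _ _ _)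

lemma termX {N : ℝ} (hN : 4 ≤ N) (r k i : ℕ) (h0 : 1 ≤ i) (h1 : i ≤ k) (h2 : k ≤ r) (h3 : r ≤ 2*k) :
    ∃ C ≥ (0:ℝ), ∀ b g, Sm b → Sm g →
      Xnorm N (fun z => Real.sqrt z ^ (2*k-r) *
        ((k.choose i : ℝ) * iteratedDeriv i b z * iteratedDeriv (k-i) g z)) ≤ C * RS N r b g := by
  obtain ⟨s, hs1, hs2, hs3, hs4⟩ : ∃ s, i ≤ s ∧ s ≤ 2*i ∧ k - i ≤ r - s ∧ r - s ≤ 2*(k-i) ∧ s ≤ r :=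
    ⟨max i (r - 2*(k-i)), by omega, by omega, by omega, by omega, by omega⟩
  obtain ⟨C1, hC1, hb'⟩ := monoB s i hs1 hs2
  obtain ⟨C2, hC2, hg'⟩ := monoX hN (r-s) (k-i) hs3 hs4.1
  refine ⟨(k.choose i : ℝ) * (C1 * C2), by positivity, fun b g hb hg => ?_⟩
  have e : (fun z => Real.sqrt z ^ (2*k-r) *
        ((k.choose i : ℝ) * iteratedDeriv i b z * iteratedDeriv (k-i) g z))
      = fun z => (k.choose i : ℝ) * ((Real.sqrt z ^ (2*i-s) * iteratedDeriv i b z) *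
        (Real.sqrt z ^ (2*(k-i)-(r-s)) * iteratedDeriv (k-i) g z)) := by
    funext z
    rw [show 2*k-r = (2*i-s) + (2*(k-i)-(r-s)) by omega, pow_add]; ring
  rw [e, Xnorm_smul, abs_of_nonneg (Nat.cast_nonneg _), mul_assoc]
  refine mul_le_mul_of_nonneg_left ?_ (Nat.cast_nonneg _)
  have h4 := Xnorm_mul_le hN (cont_mono hb (2*i-s) i) (cont_mono hg (2*(k-i)-(r-s)) (k-i)) (hb' b hb)
  refine h4.trans ?_
  have h5 : supLow s b * normN N (r-s) g ≤ RS N r b g :=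
    Finset.single_le_sum (f := fun j => supLow j b * normN N (r-j) g)
      (fun _ _ => mul_nonneg (supLow_nonneg _ _) (normN_nonneg _ _ _))
      (Finset.mem_Icc.2 ⟨by omega, by omega⟩)
  calc _ ≤ C1 * supLow s b * (C2 * normN N (r-s) g) :=
        mul_le_mul_of_nonneg_left (hg' g hg) (mul_nonneg hC1 (supLow_nonneg _ _))
    _ = C1 * C2 * (supLow s b * normN N (r-s) g) := by ring
    _ ≤ _ := mul_le_mul_of_nonneg_left h5 (by positivity)

lemma commX {N : ℝ} (hN : 4 ≤ N) {r : ℕ} {T : (ℝ → ℝ) → ℝ → ℝ} (hT : IsOrd r T) :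
    ∃ C ≥ (0:ℝ), ∀ b g, Sm b → Sm g →
      Xnorm N (fun z => T (fun z => b z * g z) z - b z * T g z) ≤ C * RS N r b g := by
  induction hT with
  | base k h1 h2 =>
    have : ∀ i : ℕ, ∃ C ≥ (0:ℝ), i < k → ∀ b g, Sm b → Sm g →
        Xnorm N (fun z => Real.sqrt z ^ (2*k-r) *
          ((k.choose (i+1) : ℝ) * iteratedDeriv (i+1) b z * iteratedDeriv (k-(i+1)) g z))
          ≤ C * RS N r b g := by
      intro i
      by_cases hi : i < k
      · obtain ⟨C, hC, h⟩ := termX hN r k (i+1) (by omega) (by omega) h1 h2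
        exact ⟨C, hC, fun _ => h⟩
      · exact ⟨0, le_rfl, fun h => absurd h hi⟩
    choose C hC h using this
    refine ⟨∑ i ∈ Finset.range k, C i, Finset.sum_nonneg fun i _ => hC i, fun b g hb hg => ?_⟩
    have e : (fun z => Real.sqrt z ^ (2*k-r) * iteratedDeriv k (fun z => b z * g z) z
          - b z * (Real.sqrt z ^ (2*k-r) * iteratedDeriv k g z))
        = fun z => ∑ i ∈ Finset.range k, Real.sqrt z ^ (2*k-r) *
          ((k.choose (i+1) : ℝ) * iteratedDeriv (i+1) b z * iteratedDeriv (k-(i+1)) g z) := by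
      funext z
      have hb1 : ContDiffAt ℝ k b z := (hb.of_le (by exact_mod_cast le_top)).contDiffAt
      have hg1 : ContDiffAt ℝ k g z := (hg.of_le (by exact_mod_cast le_top)).contDiffAt
      rw [iteratedDeriv_fun_mul hb1 hg1, Finset.sum_range_succ', ← Finset.mul_sum]
      simp; ring
    rw [e]
    refine (Xnorm_sum hN _ _ fun i _ => ?_).trans ?_
    · have := (hb.iter (i+1)).continuous
      have := (hg.iter (k-(i+1))).continuous
      have := Real.continuous_sqrt
      fun_prop
    · rw [Finset.sum_mul]
      exact Finset.sum_le_sum fun i hi => h i (Finset.mem_range.1 hi) b g hb hg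
  | add S T hS hT ihS ihT =>
    obtain ⟨C1, hC1, h1⟩ := ihS
    obtain ⟨C2, hC2, h2⟩ := ihT
    refine ⟨C1 + C2, by positivity, fun b g hb hg => ?_⟩
    have c1 : Continuous (fun z => S (fun z => b z * g z) z - b z * S g z) :=
      (hS.cont (hb.mul hg)).sub (hb.continuous.mul (hS.cont hg))
    have c2 : Continuous (fun z => T (fun z => b z * g z) z - b z * T g z) :=
      (hT.cont (hb.mul hg)).sub (hb.continuous.mul (hT.cont hg))
    have h3 := Xnorm_add hN c1 c2
    have e : (fun z => S (fun z => b z * g z) z + T (fun z => b z * g z) z - b z * (S g z + T g z))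
      = fun z => (S (fun z => b z * g z) z - b z * S g z) + (T (fun z => b z * g z) z - b z * T g z) := by
      funext z; ring
    rw [e]
    linarith [h1 b g hb hg, h2 b g hb hg]
  | smul c T hT ihT =>
    obtain ⟨C2, hC2, h2⟩ := ihT
    refine ⟨|c| * C2, by positivity, fun b g hb hg => ?_⟩
    have e : (fun z => c * T (fun z => b z * g z) z - b z * (c * T g z))
      = fun z => c * (T (fun z => b z * g z) z - b z * T g z) := by
      funext z; ring
    rw [e, Xnorm_smul, mul_assoc]
    exact mul_le_mul_of_nonneg_left (h2 b g hb hg) (abs_nonneg c)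

lemma commL {N : ℝ} (hN : 4 ≤ N) (r : ℕ) :
    ∃ C ≥ (0:ℝ), ∀ b g, Sm b → Sm g →
      Xnorm N (fun z => Lop N r (fun z => b z * g z) z - b z * Lop N r g z) ≤ C * RS N r b g := by
  obtain ⟨T, hT, h⟩ := Lop_ord N r
  obtain ⟨C, hC, h'⟩ := commX hN hT
  refine ⟨C, hC, fun b g hb hg => (le_of_eq ?_).trans (h' b g hb hg)⟩
  have hbg : Sm (fun z => b z * g z) := hb.mul hg
  refine Xnorm_congr hN ((hbg.lopc N r).sub (hb.continuous.mul (hg.lopc N r)))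
    ((hT.cont hbg).sub (hb.continuous.mul (hT.cont hg))) fun z hz => ?_
  rw [h _ hbg z hz.1.le, h _ hg z hz.1.le]

lemma zder_ord {N : ℝ} (hN : 4 ≤ N) {r : ℕ} {T : (ℝ → ℝ) → ℝ → ℝ} (hT : IsOrd r T) :
    ∃ C ≥ (0:ℝ), ∀ y, Sm y → Xnorm N (T (fun z => z * deriv y z)) ≤ C * normN N (r+1) y := by
  induction hT with
  | base k h1 h2 =>
    obtain ⟨C1, hC1, H1⟩ := monoX hN (r+1) (k+1) (by omega) (by omega)
    obtain ⟨C2, hC2, H2⟩ := monoX hN r k h1 h2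
    refine ⟨C1 + k * C2, by positivity, fun y hy => ?_⟩
    have c1 : Continuous (fun z => Real.sqrt z ^ (2*k-r+2) * iteratedDeriv (k+1) y z) := cont_mono hy _ _
    have c2 : Continuous (fun z => (k:ℝ) * (Real.sqrt z ^ (2*k-r) * iteratedDeriv k y z)) :=
      continuous_const.mul (cont_mono hy _ _)
    have c0 : Continuous (fun z => Real.sqrt z ^ (2*k-r) * iteratedDeriv k (fun z => z * deriv y z) z) :=
      cont_mono hy.der.zmul _ _
    have e : Xnorm N (fun z => Real.sqrt z ^ (2*k-r) * iteratedDeriv k (fun z => z * deriv y z) z)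
        = Xnorm N (fun z => Real.sqrt z ^ (2*k-r+2) * iteratedDeriv (k+1) y z
          + (k:ℝ) * (Real.sqrt z ^ (2*k-r) * iteratedDeriv k y z)) := by
      refine Xnorm_congr hN c0 (c1.add c2) fun z hz => ?_
      rw [pow_add, Real.sq_sqrt hz.1.le]
      cases k with
      | zero => simp
      | succ k => rw [iter_zmul hy.der, iter_shift, iter_shift]; push_cast; ring
    rw [e]
    refine (Xnorm_add hN c1 c2).trans ?_
    rw [Xnorm_smul, abs_of_nonneg (Nat.cast_nonneg k)]
    have h3 : Xnorm N (fun z => Real.sqrt z ^ (2*k-r+2) * iteratedDeriv (k+1) y z)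
        ≤ C1 * normN N (r+1) y := by
      refine le_trans ?_ (H1 y hy)
      refine Xnorm_mono hN c1 (cont_mono hy _ _) fun z hz => ?_
      rw [abs_mul, abs_mul, abs_of_nonneg (pow_nonneg (Real.sqrt_nonneg z) _),
        abs_of_nonneg (pow_nonneg (Real.sqrt_nonneg z) _)]
      exact mul_le_mul_of_nonneg_right (pow_le_pow_of_le_one (Real.sqrt_nonneg _)
        (Real.sqrt_le_one.2 hz.2) (by omega)) (abs_nonneg _)
    have h4 := (H2 y hy).trans (mul_le_mul_of_nonneg_left (normN_mono (Nat.le_succ r) y) hC2)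
    have h5 := mul_le_mul_of_nonneg_left h4 (Nat.cast_nonneg (α := ℝ) k)
    linarith
  | add S T hS hT ihS ihT =>
    obtain ⟨C1, hC1, h1⟩ := ihS
    obtain ⟨C2, hC2, h2⟩ := ihT
    refine ⟨C1 + C2, by positivity, fun y hy => ?_⟩
    have h3 := Xnorm_add hN (hS.cont hy.der.zmul) (hT.cont hy.der.zmul)
    linarith [h1 y hy, h2 y hy]
  | smul c T hT ihT =>
    obtain ⟨C2, hC2, h2⟩ := ihT
    refine ⟨|c| * C2, by positivity, fun y hy => ?_⟩
    rw [Xnorm_smul, mul_assoc]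
    exact mul_le_mul_of_nonneg_left (h2 y hy) (abs_nonneg c)

lemma zder_g {N : ℝ} (hN : 4 ≤ N) (r : ℕ) :
    ∃ C ≥ (0:ℝ), ∀ y, Sm y → gnorm N r (fun z => z * deriv y z) ≤ C * normN N (r+1) y := by
  obtain ⟨T, hT, h⟩ := Lop_ord N r
  obtain ⟨C, hC, h'⟩ := zder_ord hN hT
  refine ⟨C, hC, fun y hy => (le_of_eq ?_).trans (h' y hy)⟩
  rw [gnorm_eq]
  exact Xnorm_congr hN (hy.der.zmul.lopc N r) (hT.cont hy.der.zmul) fun z hz => h _ hy.der.zmul z hz.1.le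

/-- uniform constant for all orders up to `n` -/
lemma zder_n {N : ℝ} (hN : 4 ≤ N) (n : ℕ) :
    ∃ C ≥ (0:ℝ), ∀ r ≤ n, ∀ y, Sm y → normN N r (fun z => z * deriv y z) ≤ C * normN N (r+1) y := by
  choose C hC h using zder_g hN
  have hS : 0 ≤ ∑ i ∈ Finset.range (n+1), C i := Finset.sum_nonneg fun i _ => hC i
  refine ⟨(n+1) * ∑ i ∈ Finset.range (n+1), C i, by positivity, fun r hr y hy => ?_⟩
  have h1 : normN N r (fun z => z * deriv y z)
      ≤ (r+1) * ((∑ i ∈ Finset.range (n+1), C i) * normN N (r+1) y) := by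
    apply normN_le_of
    intro ℓ hℓ
    refine (h ℓ y hy).trans ?_
    refine mul_le_mul ?_ (normN_mono (by omega) y) (normN_nonneg _ _ _) hS
    exact Finset.single_le_sum (fun i _ => hC i) (Finset.mem_range.2 (by omega))
  refine h1.trans ?_
  rw [mul_assoc]
  have : (r:ℝ) ≤ n := by exact_mod_cast hr
  exact mul_le_mul_of_nonneg_right (by linarith) (mul_nonneg hS (normN_nonneg _ _ _))

lemma normN_del {N : ℝ} (r : ℕ) (y : ℝ → ℝ) : normN N r (Del N y) ≤ normN N (r+2) y := by
  apply Real.sqrt_le_sqrt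
  have e : ∀ ℓ, gnorm N ℓ (Del N y) = gnorm N (ℓ+2) y := fun ℓ => by
    rw [gnorm_eq, gnorm_eq, Lop_add_two]
  simp only [e]
  rw [Finset.sum_range_succ' _ (r+2), Finset.sum_range_succ' _ (r+1)]
  nlinarith [sq_nonneg (gnorm N 0 y), sq_nonneg (gnorm N (0+1) y)]

/-- The combined low norm of the three coefficients. -/
noncomputable def UU (b₂ b₁ b₀ : ℝ → ℝ) (j : ℕ) : ℝ := supLow j b₂ + supLow j b₁ + supLow j b₀

lemma UU_nonneg (b₂ b₁ b₀ : ℝ → ℝ) (j : ℕ) : 0 ≤ UU b₂ b₁ b₀ j :=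
  add_nonneg (add_nonneg (supLow_nonneg _ _) (supLow_nonneg _ _)) (supLow_nonneg _ _)

lemma UU_mono (b₂ b₁ b₀ : ℝ → ℝ) {i j : ℕ} (h : i ≤ j) : UU b₂ b₁ b₀ i ≤ UU b₂ b₁ b₀ j :=
  add_le_add (add_le_add (supLow_mono h _) (supLow_mono h _)) (supLow_mono h _)

lemma supLow_succ (j : ℕ) (b : ℝ → ℝ) : supLow (j+1) b = supLow j b + supN (Ddot^[j+1] b) := by
  unfold supLow; rw [Finset.sum_range_succ]

lemma UU_convex {b₂ b₁ b₀ : ℝ → ℝ} (h2 : Sm b₂) (h1 : Sm b₁) (h0 : Sm b₀) (j : ℕ) :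
    UU b₂ b₁ b₀ (j+1) ^ 2 ≤ 100 * (UU b₂ b₁ b₀ j * UU b₂ b₁ b₀ (j+2)) := by
  have l2 := landau h2 j
  have l1 := landau h1 j
  have l0 := landau h0 j
  have e : ∀ b : ℝ → ℝ, supN (Ddot^[j] b) + supN (Ddot^[j+2] b) ≤ supLow (j+2) b := fun b => by
    rw [supLow_succ (j+1)]
    have := supN_le_supLow (show j ≤ j+1 by omega) b
    have := supLow_nonneg (j+1) b
    linarith
  have k : ∀ b : ℝ → ℝ, supN (Ddot^[j+1] b) ^ 2
      ≤ 8 * (supN (Ddot^[j] b) * (supN (Ddot^[j] b) + supN (Ddot^[j+2] b))) →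
      supN (Ddot^[j+1] b) ^ 2 ≤ 8 * (supLow j b * supLow (j+2) b) := fun b hb => by
    refine hb.trans ?_
    have := mul_le_mul (supN_le_supLow (le_refl j) b) (e b)
      (add_nonneg (supN_nonneg _) (supN_nonneg _)) (supLow_nonneg j b)
    linarith
  have k2 := k _ l2
  have k1 := k _ l1
  have k0 := k _ l0
  have m := UU_mono b₂ b₁ b₀ (show j ≤ j+2 by omega)
  have hu := UU_nonneg b₂ b₁ b₀ j
  have hs : UU b₂ b₁ b₀ (j+1) = UU b₂ b₁ b₀ j
      + (supN (Ddot^[j+1] b₂) + supN (Ddot^[j+1] b₁) + supN (Ddot^[j+1] b₀)) := by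
    unfold UU; rw [supLow_succ, supLow_succ, supLow_succ]; ring
  have hp : supLow j b₂ * supLow (j+2) b₂ + supLow j b₁ * supLow (j+2) b₁
      + supLow j b₀ * supLow (j+2) b₀ ≤ UU b₂ b₁ b₀ j * UU b₂ b₁ b₀ (j+2) := by
    unfold UU
    have a2 := supLow_nonneg j b₂
    have a1 := supLow_nonneg j b₁
    have a0 := supLow_nonneg j b₀
    have c2 := supLow_nonneg (j+2) b₂
    have c1 := supLow_nonneg (j+2) b₁
    have c0 := supLow_nonneg (j+2) b₀
    nlinarith [mul_nonneg a2 c1, mul_nonneg a2 c0, mul_nonneg a1 c2, mul_nonneg a1 c0,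
      mul_nonneg a0 c2, mul_nonneg a0 c1]
  have hP : UU b₂ b₁ b₀ j ^ 2 ≤ UU b₂ b₁ b₀ j * UU b₂ b₁ b₀ (j+2) := by
    rw [pow_two]; exact mul_le_mul_of_nonneg_left m hu
  rw [hs]
  generalize supN (Ddot^[j+1] b₂) = s2 at *
  generalize supN (Ddot^[j+1] b₁) = s1 at *
  generalize supN (Ddot^[j+1] b₀) = s0 at *
  generalize UU b₂ b₁ b₀ j * UU b₂ b₁ b₀ (j+2) = P at *
  generalize UU b₂ b₁ b₀ j = u at *
  nlinarith [sq_nonneg (u - (s2+s1+s0)), sq_nonneg (s2 - s1), sq_nonneg (s2-s0), sq_nonneg (s1-s0),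
    sq_nonneg u]

lemma lop_mul {N : ℝ} (hN : 4 ≤ N) (r : ℕ) :
    ∃ C ≥ (0:ℝ), ∀ b g, Sm b → Sm g →
      Xnorm N (fun z => Lop N r (fun z => b z * g z) z - b z * Lop N r g z) ≤ C * RS N r b g ∧
      Xnorm N (Lop N r (fun z => b z * g z)) ≤ C * RS N r b g + supLow 0 b * gnorm N r g := by
  obtain ⟨C, hC, h⟩ := commL hN r
  refine ⟨C, hC, fun b g hb hg => ⟨h b g hb hg, ?_⟩⟩
  have hbg : Sm (fun z => b z * g z) := hb.mul hg
  have c1 := hbg.lopc N r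
  have c2 := hg.lopc N r
  have c3 := hb.continuous
  have e : Lop N r (fun z => b z * g z) = fun z =>
      (Lop N r (fun z => b z * g z) z - b z * Lop N r g z) + b z * Lop N r g z := by
    funext z; ring
  rw [e]
  refine (Xnorm_add hN (c1.sub (c3.mul c2)) (c3.mul c2)).trans (add_le_add (h b g hb hg) ?_)
  rw [gnorm_eq]
  refine Xnorm_mul_le hN c3 c2 fun z hz => ?_
  exact (le_supN hb 0 ⟨hz.1.le, hz.2⟩).trans (supN_le_supLow le_rfl b)

lemma mainstep {N : ℝ} (hN : 4 ≤ N) (n : ℕ) :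
    ∃ C ≥ (0:ℝ), ∀ b₂ b₁ b₀ y : ℝ → ℝ, Sm b₂ → Sm b₁ → Sm b₀ → Sm y →
      (∀ z ∈ Icc (0:ℝ) 1, |b₂ z - 1| ≤ 1 / 2) →
      gnorm N (n+2) y ≤ C * (normN N n (opAs N b₂ b₁ b₀ y)
        + (∑ j ∈ Finset.Icc 1 n, UU b₂ b₁ b₀ j * normN N (n+2-j) y)
        + UU b₂ b₁ b₀ 0 * normN N (n+1) y) := by
  obtain ⟨C, hC, hc⟩ := lop_mul hN n
  obtain ⟨D, hD, hd⟩ := zder_n hN n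
  refine ⟨2 * (1 + C * (2 + D) + (D + 1)), by positivity, fun b₂ b₁ b₀ y h2 h1 h0 hy hb => ?_⟩
  have hDy : Sm (Del N y) := hy.del N
  have hzy : Sm (fun z => z * deriv y z) := hy.der.zmul
  set T := ∑ j ∈ Finset.Icc 1 n, UU b₂ b₁ b₀ j * normN N (n+2-j) y with hT
  have hT0 : 0 ≤ T := Finset.sum_nonneg fun j _ => mul_nonneg (UU_nonneg _ _ _ _) (normN_nonneg _ _ _)
  have u2 : ∀ j, supLow j b₂ ≤ UU b₂ b₁ b₀ j := fun j => by
    have := supLow_nonneg j b₁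
    have := supLow_nonneg j b₀
    unfold UU; linarith
  have u1 : ∀ j, supLow j b₁ ≤ UU b₂ b₁ b₀ j := fun j => by
    have := supLow_nonneg j b₂
    have := supLow_nonneg j b₀
    unfold UU; linarith
  have u0 : ∀ j, supLow j b₀ ≤ UU b₂ b₁ b₀ j := fun j => by
    have := supLow_nonneg j b₂
    have := supLow_nonneg j b₁
    unfold UU; linarith
  have r2 : RS N n b₂ (Del N y) ≤ T := by
    refine Finset.sum_le_sum fun j hj => ?_
    have hj' := Finset.mem_Icc.1 hj
    refine mul_le_mul (u2 j) ((normN_del _ _).trans (normN_mono (by omega) _)) (normN_nonneg _ _ _)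
      (UU_nonneg _ _ _ _)
  have r1 : RS N n b₁ (fun z => z * deriv y z) ≤ D * T := by
    rw [hT, Finset.mul_sum]
    refine Finset.sum_le_sum fun j hj => ?_
    have hj' := Finset.mem_Icc.1 hj
    have q := (hd (n-j) (by omega) y hy).trans
      (mul_le_mul_of_nonneg_left (normN_mono (show n-j+1 ≤ n+2-j by omega) y) hD)
    have := mul_le_mul (u1 j) q (normN_nonneg _ _ _) (UU_nonneg b₂ b₁ b₀ j)
    linarith
  have r0 : RS N n b₀ y ≤ T := by
    refine Finset.sum_le_sum fun j hj => ?_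
    exact mul_le_mul (u0 j) (normN_mono (by omega) _) (normN_nonneg _ _ _) (UU_nonneg _ _ _ _)
  have hv : 0 ≤ normN N (n+1) y := normN_nonneg _ _ _
  have hU := UU_nonneg b₂ b₁ b₀ 0
  have g1 : supLow 0 b₁ * gnorm N n (fun z => z * deriv y z)
      ≤ UU b₂ b₁ b₀ 0 * (D * normN N (n+1) y) :=
    mul_le_mul (u1 0) ((gnorm_le le_rfl _).trans (hd n le_rfl y hy)) (gnorm_nonneg _ _ _) hU
  have g0 : supLow 0 b₀ * gnorm N n y ≤ UU b₂ b₁ b₀ 0 * normN N (n+1) y :=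
    mul_le_mul (u0 0) (gnorm_le (by omega) _) (gnorm_nonneg _ _ _) hU
  have s2 : Sm (fun z => b₂ z * Del N y z) := h2.mul hDy
  have s1 : Sm (fun z => b₁ z * (z * deriv y z)) := h1.mul hzy
  have s0 : Sm (fun z => b₀ z * y z) := h0.mul hy
  have sA : Sm (opAs N b₂ b₁ b₀ y) := ((h2.neg.mul hDy).add s1).add s0
  have id : ∀ z, 0 ≤ z → Lop N n (opAs N b₂ b₁ b₀ y) z + Lop N n (fun z => b₂ z * Del N y z) z
      = Lop N n (fun z => b₁ z * (z * deriv y z)) z + Lop N n (fun z => b₀ z * y z) z := by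
    intro z hz
    rw [← Lop_add N n sA s2 z hz, ← Lop_add N n s1 s0 z hz]
    congr 1
    congr 1
    funext z
    unfold opAs; ring
  have cA := sA.lopc N n
  have c2 := s2.lopc N n
  have c1 := s1.lopc N n
  have c0 := s0.lopc N n
  have cD := hDy.lopc N n
  have cb := h2.continuous
  have X1 : Xnorm N (fun z => b₂ z * Lop N n (Del N y) z)
      ≤ (Xnorm N (Lop N n (fun z => b₁ z * (z * deriv y z))) + Xnorm N (Lop N n (fun z => b₀ z * y z)))
       + (Xnorm N (Lop N n (opAs N b₂ b₁ b₀ y)) + Xnorm N (fun z =>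
         Lop N n (fun z => b₂ z * Del N y z) z - b₂ z * Lop N n (Del N y) z)) := by
    have cc := c2.sub (cb.mul cD)
    rw [Xnorm_congr hN (f := fun z => b₂ z * Lop N n (Del N y) z) (cb.mul cD) (g := fun z =>
        (Lop N n (fun z => b₁ z * (z * deriv y z)) z + Lop N n (fun z => b₀ z * y z) z)
        + (-1) * (Lop N n (opAs N b₂ b₁ b₀ y) z +
          (Lop N n (fun z => b₂ z * Del N y z) z - b₂ z * Lop N n (Del N y) z)))
      ((c1.add c0).add (continuous_const.mul (cA.add cc)))
      (fun z hz => by have := id z hz.1.le; linarith)]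
    refine (Xnorm_add hN (c1.add c0) (continuous_const.mul (cA.add cc))).trans
      (add_le_add (Xnorm_add hN c1 c0) ?_)
    refine (Xnorm_smul N (-1) (fun z => Lop N n (opAs N b₂ b₁ b₀ y) z +
      (Lop N n (fun z => b₂ z * Del N y z) z - b₂ z * Lop N n (Del N y) z))).le.trans ?_
    rw [abs_neg, abs_one, one_mul]
    exact Xnorm_add hN cA cc
  have X2 : (1/2) * gnorm N (n+2) y ≤ Xnorm N (fun z => b₂ z * Lop N n (Del N y) z) := by
    rw [gnorm_eq, Lop_add_two, show (1/2:ℝ) = |1/2| by rw [abs_of_nonneg]; norm_num, ← Xnorm_smul]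
    refine Xnorm_mono hN (continuous_const.mul cD) (cb.mul cD) fun z hz => ?_
    rw [abs_mul, abs_mul]
    refine mul_le_mul_of_nonneg_right ?_ (abs_nonneg _)
    have := abs_le.1 (hb z ⟨hz.1.le, hz.2⟩)
    rw [abs_of_nonneg (by norm_num : (0:ℝ) ≤ 1/2), abs_of_nonneg (by linarith)]
    linarith
  have X3 : Xnorm N (Lop N n (opAs N b₂ b₁ b₀ y)) ≤ normN N n (opAs N b₂ b₁ b₀ y) := by
    rw [← gnorm_eq]; exact gnorm_le le_rfl _
  have Y2 := (hc b₂ _ h2 hDy).1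
  have Y1 := (hc b₁ _ h1 hzy).2
  have Y0 := (hc b₀ _ h0 hy).2
  have Z2 := mul_le_mul_of_nonneg_left r2 hC
  have Z1 := mul_le_mul_of_nonneg_left r1 hC
  have Z0 := mul_le_mul_of_nonneg_left r0 hC
  have ha : 0 ≤ normN N n (opAs N b₂ b₁ b₀ y) := normN_nonneg _ _ _
  have hW : 0 ≤ UU b₂ b₁ b₀ 0 * normN N (n+1) y := mul_nonneg hU hv
  have F : (1/2) * gnorm N (n+2) y ≤ normN N n (opAs N b₂ b₁ b₀ y) + C * (2 + D) * T
      + (D+1) * (UU b₂ b₁ b₀ 0 * normN N (n+1) y) := by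
    have : C * (2 + D) * T = C * T + C * (D * T) + C * T := by ring
    have : (D+1) * (UU b₂ b₁ b₀ 0 * normN N (n+1) y) =
      UU b₂ b₁ b₀ 0 * (D * normN N (n+1) y) + UU b₂ b₁ b₀ 0 * normN N (n+1) y := by ring
    linarith
  generalize normN N n (opAs N b₂ b₁ b₀ y) = a at *
  generalize UU b₂ b₁ b₀ 0 * normN N (n+1) y = W at *
  have hE : 0 ≤ C * (2 + D) := by positivity
  generalize C * (2 + D) = E at *
  have m1 := mul_nonneg hE ha
  have m2 := mul_nonneg hE hW
  have m3 := mul_nonneg hD ha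
  have m4 := mul_nonneg hD hT0
  have e : 2 * (1 + E + (D + 1)) * (a + T + W)
    = 2 * (a + E * T + (D+1) * W) + 2 * (E * a) + 2 * (E * W) + 2 * (D * a) + 2*(D * T)
      + 2 * a + 4 * T + 2 * W := by ring
  rw [e]; linarith

lemma highterm {N : ℝ} (hN : 4 ≤ N) (n : ℕ) {b₂ b₁ b₀ y : ℝ → ℝ}
    (h2 : Sm b₂) (h1 : Sm b₁) (h0 : Sm b₀) (hy : Sm y) {M : ℝ} (hM : 0 < M)
    (hU : UU b₂ b₁ b₀ 6 ≤ M) (j : ℕ) (hj1 : 1 ≤ j) (hj : j ≤ n) :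
    UU b₂ b₁ b₀ j * normN N (n+2-j) y ≤ (100*(N+8))^((n-5)*(n-5)) *
      (M * normN N (n+1) y + UU b₂ b₁ b₀ (n+4) * normN N 1 y) := by
  have hK : 1 < 100*(N+8) := by linarith
  have hKp : 1 ≤ (100*(N+8))^((n-5)*(n-5)) := one_le_pow₀ hK.le
  have hv : 0 ≤ M * normN N (n+1) y := mul_nonneg hM.le (normN_nonneg _ _ _)
  have hw : 0 ≤ UU b₂ b₁ b₀ (n+4) * normN N 1 y := mul_nonneg (UU_nonneg _ _ _ _) (normN_nonneg _ _ _)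
  rcases le_or_gt j 6 with h6 | h6
  · have q : UU b₂ b₁ b₀ j * normN N (n+2-j) y ≤ M * normN N (n+1) y :=
      mul_le_mul ((UU_mono _ _ _ h6).trans hU) (normN_mono (by omega) _) (normN_nonneg _ _ _) hM.le
    have := mul_le_mul_of_nonneg_right hKp (add_nonneg hv hw)
    linarith
  · have ch := chain hK (n-5) (fun i => UU b₂ b₁ b₀ (6+i) * normN N (n-4-i) y)
      (fun i => mul_nonneg (UU_nonneg _ _ _ _) (normN_nonneg _ _ _)) (fun i hi => by
        have a := UU_convex h2 h1 h0 (6+i)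
        have b := interpX hN (n-4-(i+2)) hy
        rw [show n-4-(i+2)+1 = n-4-(i+1) by omega, show n-4-(i+2)+2 = n-4-i by omega] at b
        have := mul_le_mul a b (sq_nonneg _) (mul_nonneg (by norm_num)
          (mul_nonneg (UU_nonneg _ _ _ _) (UU_nonneg _ _ _ _)))
        simp only [← add_assoc] at this ⊢
        calc _ = _ := by rw [mul_pow]
          _ ≤ _ := this
          _ = _ := by ring) (j-6) (by omega)
    simp only [show 6 + (j-6) = j by omega, show n-4-(j-6) = n+2-j by omega,
      show 6 + (n-5) = n+1 by omega, show n-4-(n-5) = 1 by omega] at ch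
    refine ch.trans (mul_le_mul_of_nonneg_left ?_ (by linarith))
    refine add_le_add (mul_le_mul hU (normN_mono (by omega) _) (normN_nonneg _ _ _) hM.le)
      (mul_le_mul_of_nonneg_right (UU_mono _ _ _ (by omega)) (normN_nonneg _ _ _))

lemma stepbound {N : ℝ} (hN : 4 ≤ N) (n : ℕ) {M : ℝ} (hM : 0 < M) :
    ∃ C ≥ (0:ℝ), ∀ b₂ b₁ b₀ y : ℝ → ℝ, Sm b₂ → Sm b₁ → Sm b₀ → Sm y →
      (∀ z ∈ Icc (0:ℝ) 1, |b₂ z - 1| ≤ 1 / 2) → UU b₂ b₁ b₀ 6 ≤ M →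
      normN N (n+2) y ≤ C * (normN N n (opAs N b₂ b₁ b₀ y) + normN N (n+1) y
        + UU b₂ b₁ b₀ (n+4) * normN N 1 y) := by
  obtain ⟨C, hC, hc⟩ := mainstep hN n
  have hK0 : 0 ≤ (100*(N+8))^((n-5)*(n-5)) := pow_nonneg (by linarith) _
  have hK : ∃ K : ℝ, K = n * (100*(N+8))^((n-5)*(n-5)) := ⟨_, rfl⟩
  obtain ⟨K, hKe⟩ := hK
  have hKn : 0 ≤ K := hKe ▸ mul_nonneg (Nat.cast_nonneg _) hK0
  refine ⟨1 + C * (1 + K * M + K + M), by positivity, fun b₂ b₁ b₀ y h2 h1 h0 hy hb hU => ?_⟩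
  have A := hc b₂ b₁ b₀ y h2 h1 h0 hy hb
  have B : (∑ j ∈ Finset.Icc 1 n, UU b₂ b₁ b₀ j * normN N (n+2-j) y)
      ≤ K * (M * normN N (n+1) y + UU b₂ b₁ b₀ (n+4) * normN N 1 y) := by
    refine (Finset.sum_le_card_nsmul _ _ _ fun j hj =>
      highterm hN n h2 h1 h0 hy hM hU j (Finset.mem_Icc.1 hj).1 (Finset.mem_Icc.1 hj).2).trans ?_
    rw [Nat.card_Icc, nsmul_eq_mul, hKe, Nat.add_sub_cancel, mul_assoc]
  have D : UU b₂ b₁ b₀ 0 * normN N (n+1) y ≤ M * normN N (n+1) y :=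
    mul_le_mul_of_nonneg_right ((UU_mono _ _ _ (by omega)).trans hU) (normN_nonneg _ _ _)
  have E := normN_succ_le N (n+1) y
  have ha : 0 ≤ normN N n (opAs N b₂ b₁ b₀ y) := normN_nonneg _ _ _
  have hv : 0 ≤ normN N (n+1) y := normN_nonneg _ _ _
  have hw : 0 ≤ UU b₂ b₁ b₀ (n+4) * normN N 1 y := mul_nonneg (UU_nonneg _ _ _ _) (normN_nonneg _ _ _)
  have A' := A.trans (mul_le_mul_of_nonneg_left (add_le_add (add_le_add le_rfl B) D) hC)
  generalize normN N n (opAs N b₂ b₁ b₀ y) = a at *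
  generalize UU b₂ b₁ b₀ (n+4) * normN N 1 y = w at *
  have E' : normN N (n+2) y ≤ normN N (n+1) y + gnorm N (n+2) y := E
  generalize normN N (n+1) y = v at *
  have e : (1 + C * (1 + K * M + K + M)) * (a + v + w) - (v + C * (a + K * (M * v + w) + M * v))
    = a + w + C * ((K*M+K+M) * a + (1 + K) * v + (1 + K*M+M) * w) := by ring
  have p : 0 ≤ a + w + C * ((K*M+K+M) * a + (1 + K) * v + (1 + K*M+M) * w) := by positivity
  linarith

lemma finalbound {N : ℝ} (hN : 4 ≤ N) {M : ℝ} (hM : 0 < M) (n : ℕ) :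
    ∃ C > (0:ℝ), ∀ b₂ b₁ b₀ y : ℝ → ℝ, Sm b₂ → Sm b₁ → Sm b₀ → Sm y →
      (∀ z ∈ Icc (0:ℝ) 1, |b₂ z - 1| ≤ 1 / 2) → UU b₂ b₁ b₀ 6 ≤ M →
      normN N (n+2) y ≤ C * (normN N n (opAs N b₂ b₁ b₀ y)
        + (1 + UU b₂ b₁ b₀ (n+4)) * normN N 1 y) := by
  induction n with
  | zero =>
    obtain ⟨C, hC, h⟩ := stepbound hN 0 hM
    refine ⟨C + 1, by positivity, fun b₂ b₁ b₀ y h2 h1 h0 hy hb hU => ?_⟩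
    have A := h b₂ b₁ b₀ y h2 h1 h0 hy hb hU
    have p : 0 ≤ normN N 0 (opAs N b₂ b₁ b₀ y) + (1 + UU b₂ b₁ b₀ (0+4)) * normN N 1 y :=
      add_nonneg (normN_nonneg _ _ _)
        (mul_nonneg (add_nonneg zero_le_one (UU_nonneg _ _ _ _)) (normN_nonneg _ _ _))
    have e : normN N 0 (opAs N b₂ b₁ b₀ y) + normN N (0+1) y + UU b₂ b₁ b₀ (0+4) * normN N 1 y
      = normN N 0 (opAs N b₂ b₁ b₀ y) + (1 + UU b₂ b₁ b₀ (0+4)) * normN N 1 y := by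
      rw [zero_add 1]; ring
    rw [e] at A
    linarith
  | succ n ih =>
    obtain ⟨D, hD, ih⟩ := ih
    obtain ⟨C, hC, h⟩ := stepbound hN (n+1) hM
    refine ⟨C * (1 + D) + 1, by positivity, fun b₂ b₁ b₀ y h2 h1 h0 hy hb hU => ?_⟩
    have A := h b₂ b₁ b₀ y h2 h1 h0 hy hb hU
    have B := ih b₂ b₁ b₀ y h2 h1 h0 hy hb hU
    have m1 := normN_mono (N := N) (show n ≤ n+1 by omega) (opAs N b₂ b₁ b₀ y)
    have m2 := mul_le_mul_of_nonneg_right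
      (UU_mono b₂ b₁ b₀ (show n+4 ≤ n+1+4 by omega)) (normN_nonneg N 1 y)
    have hv := normN_nonneg N 1 y
    have ha := normN_nonneg N (n+1) (opAs N b₂ b₁ b₀ y)
    have hw := mul_nonneg (UU_nonneg b₂ b₁ b₀ (n+1+4)) hv
    have B' : normN N (n+1+1) y ≤ D * (normN N (n+1) (opAs N b₂ b₁ b₀ y)
        + (1 + UU b₂ b₁ b₀ (n+1+4)) * normN N 1 y) :=
      B.trans (mul_le_mul_of_nonneg_left (by linarith) hD.le)
    have A' := A.trans (mul_le_mul_of_nonneg_left (add_le_add (add_le_add le_rfl B') le_rfl) hC)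
    refine A'.trans ?_
    generalize UU b₂ b₁ b₀ (n+1+4) = u at *
    generalize normN N 1 y = v at *
    generalize normN N (n+1) (opAs N b₂ b₁ b₀ y) = a at *
    have e : (C * (1 + D) + 1) * (a + (1 + u) * v) - C * (a + D * (a + (1 + u) * v) + u * v)
      = C * v + a + v + u * v := by ring
    have p : 0 ≤ C * v := mul_nonneg hC hv
    linarith

theorem stmt10 (N : ℝ) (hN : 4 ≤ N) (n : ℕ) (M : ℝ) (hM : 0 < M) :
    ∃ C > (0:ℝ), ∀ b₂ b₁ b₀ : ℝ → ℝ,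
      ContDiff ℝ (⊤ : ℕ∞) b₂ → ContDiff ℝ (⊤ : ℕ∞) b₁ → ContDiff ℝ (⊤ : ℕ∞) b₀ →
      (∀ z ∈ Icc (0:ℝ) 1, |b₂ z - 1| ≤ 1 / 2) →
      supLow 6 b₂ + supLow 6 b₁ + supLow 6 b₀ ≤ M →
      ∀ y : ℝ → ℝ, ContDiff ℝ (⊤ : ℕ∞) y →
        normN N (n + 2) y
          ≤ C * (normN N n (opAs N b₂ b₁ b₀ y)
              + (1 + (supLow (n + 4) b₂ + supLow (n + 4) b₁ + supLow (n + 4) b₀))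
                  * normN N 1 y) := by
  obtain ⟨C, hC, h⟩ := finalbound hN hM n
  exact ⟨C, hC, fun b₂ b₁ b₀ h2 h1 h0 hb hU y hy => h b₂ b₁ b₀ y h2 h1 h0 hy hb hU⟩
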